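/- arXiv:2510.26039 — 5 statements merged into one kernel-verified Lean document; each statement's English description precedes it below -/
import Mathlib

section
/- Let q, λ > 0 and let W_q, W_{q+λ} : ℝ → ℝ vanish on (−∞, 0) and be continuous and locally integrable on [0, ∞); set Z_q(x) := 1 + q ∫₀^{max(x,0)} W_q(y) dy and Z_{q+λ}(x) := 1 + (q+λ) ∫₀^{max(x,0)} W_{q+λ}(y) dy. Assume that for all x ≥ 0 both λ ∫₀^x W_{q+λ}(x − u) W_q(u) du = W_{q+λ}(x) − W_q(x) and λ ∫₀^x W_{q+λ}(x − u) Z_q(u) du = Z_{q+λ}(x) − Z_q(x) hold. For a < b and x ∈ ℝ define 𝒵_b(x, a) := Z_{q+λ}(x − a) − λ ∫_b^x W_q(x − z) Z_{q+λ}(z − a) dz. Then for all a < b < c, ∫_b^c W_{q+λ}(c − y) 𝒵_b(y, a) dy = (Z_{q+λ}(c − a) − 𝒵_b(c, a)) / λ. -/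
open MeasureTheory Filter Set Real

/-- Fubini's theorem on the triangle `b < z ≤ y ≤ c`. -/
theorem intervalIntegral_triangle_swap {φ : ℝ → ℝ → ℝ} (hφ : Continuous (Function.uncurry φ))
    {b c : ℝ} (hbc : b ≤ c) :
    (∫ y in b..c, ∫ z in b..y, φ y z) = ∫ z in b..c, ∫ y in z..c, φ y z := by
  set T : Set (ℝ × ℝ) := {p | p.2 ≤ p.1}
  have hT : MeasurableSet T := measurableSet_le measurable_snd measurable_fst
  have hint : Integrable (T.indicator (Function.uncurry φ))
      ((volume.restrict (Ioc b c)).prod (volume.restrict (Ioc b c))) := by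
    rw [Measure.prod_restrict]
    refine Integrable.indicator ?_ hT
    exact (hφ.continuousOn.integrableOn_compact (isCompact_Icc.prod isCompact_Icc)).mono_set
      (Set.prod_mono Ioc_subset_Icc_self Ioc_subset_Icc_self)
  have hswap := integral_integral_swap (f := fun y z => T.indicator (Function.uncurry φ) (y, z)) hint
  rw [intervalIntegral.integral_of_le hbc, intervalIntegral.integral_of_le hbc]
  convert hswap using 1
  · refine setIntegral_congr_fun measurableSet_Ioc fun y hy => ?_
    have : (fun z => T.indicator (Function.uncurry φ) (y, z)) = (Iic y).indicator (φ y) := by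
      ext z; simp [T, Set.indicator, Function.uncurry]
    simp only [this]
    rw [setIntegral_indicator measurableSet_Iic, intervalIntegral.integral_of_le hy.1.le,
      Ioc_inter_Iic, min_eq_right hy.2]
  · refine setIntegral_congr_fun measurableSet_Ioc fun z hz => ?_
    have : (fun y => T.indicator (Function.uncurry φ) (y, z)) =
        (Ici z).indicator (fun y => φ y z) := by
      ext y; simp [T, Set.indicator, Function.uncurry]
    simp only [this]
    rw [setIntegral_indicator measurableSet_Ici, intervalIntegral.integral_of_le hz.2,
      ← integral_Icc_eq_integral_Ioc]
    congr 2
    ext y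
    simp only [mem_Icc, mem_inter_iff, mem_Ioc, mem_Ici]
    exact ⟨fun h => ⟨⟨hz.1.trans_le h.1, h.2⟩, h.1⟩, fun h => ⟨h.2, h.1.2⟩⟩

/-- If `l • (f * g) = f - g` for the convolution on the half-line, then the same resolvent
relation holds after convolving with a continuous function from the base point `b`. -/
theorem integral_resolvent_conv {f g h : ℝ → ℝ} {l b c : ℝ}
    (hf : Continuous f) (hg : Continuous g) (hh : Continuous h)
    (hfg : ∀ x, 0 ≤ x → l * (∫ u in (0:ℝ)..x, f (x - u) * g u) = f x - g x) (hbc : b ≤ c) :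
    (∫ y in b..c, f (c - y) * (h y - l * ∫ z in b..y, g (y - z) * h z)) =
      ∫ z in b..c, g (c - z) * h z := by
  have hinner : Continuous fun y => ∫ z in b..y, g (y - z) * h z :=
    intervalIntegral.continuous_parametric_intervalIntegral_of_continuous
      (f := fun y z => g (y - z) * h z) (by fun_prop) continuous_id
  have hdouble : (∫ y in b..c, f (c - y) * (l * ∫ z in b..y, g (y - z) * h z)) =
      ∫ z in b..c, (f (c - z) - g (c - z)) * h z := by
    have hswap := intervalIntegral_triangle_swap
      (φ := fun y z => f (c - y) * (l * (g (y - z) * h z))) (by fun_prop) hbc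
    simp only [intervalIntegral.integral_const_mul] at hswap
    rw [hswap]
    refine intervalIntegral.integral_congr fun z hz => ?_
    rw [uIcc_of_le hbc] at hz
    have hconv := hfg (c - z) (sub_nonneg.2 hz.2)
    have hshift := intervalIntegral.integral_comp_sub_right
      (fun u => f (c - z - u) * g u) z (a := z) (b := c)
    rw [sub_self] at hshift
    rw [← hconv, ← hshift, ← intervalIntegral.integral_const_mul,
      ← intervalIntegral.integral_mul_const]
    refine intervalIntegral.integral_congr fun y _ => ?_
    simp only [sub_sub_sub_cancel_right]
    ring
  simp only [mul_sub]
  rw [intervalIntegral.integral_sub (Continuous.intervalIntegrable (by fun_prop) _ _)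
    (Continuous.intervalIntegrable (by fun_prop) _ _), hdouble,
    ← intervalIntegral.integral_sub (Continuous.intervalIntegrable (by fun_prop) _ _)
    (Continuous.intervalIntegrable (by fun_prop) _ _)]
  refine intervalIntegral.integral_congr fun z _ => ?_
  ring

theorem continuous_comp_max_zero {f : ℝ → ℝ} (hf : ContinuousOn f (Ici 0)) :
    Continuous fun x => f (max x 0) :=
  hf.comp_continuous (by fun_prop) fun x => le_max_right x 0

/-- Identity (P1 misc 1) of the paper:
`∫_b^c W_{q+λ}(c - y) 𝒵_b(y, a) dy = (Z_{q+λ}(c - a) - 𝒵_b(c, a)) / λ` for `a < b < c`. -/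
theorem Zscr_integral_identity
    (q lam : ℝ) (hq : 0 < q) (hlam : 0 < lam)
    (Wq Wql : ℝ → ℝ)
    (hWq0 : ∀ x < (0:ℝ), Wq x = 0) (hWql0 : ∀ x < (0:ℝ), Wql x = 0)
    (hWqc : ContinuousOn Wq (Set.Ici 0)) (hWqlc : ContinuousOn Wql (Set.Ici 0))
    (hWqi : LocallyIntegrableOn Wq (Set.Ici 0))
    (hWqli : LocallyIntegrableOn Wql (Set.Ici 0))
    (Zq Zql : ℝ → ℝ)
    (hZq : ∀ x : ℝ, Zq x = 1 + q * ∫ y in (0:ℝ)..(max x 0), Wq y)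
    (hZql : ∀ x : ℝ, Zql x = 1 + (q + lam) * ∫ y in (0:ℝ)..(max x 0), Wql y)
    (hconvW : ∀ x : ℝ, 0 ≤ x →
      lam * (∫ u in (0:ℝ)..x, Wql (x - u) * Wq u) = Wql x - Wq x)
    (hconvZ : ∀ x : ℝ, 0 ≤ x →
      lam * (∫ u in (0:ℝ)..x, Wql (x - u) * Zq u) = Zql x - Zq x)
    (Zs : ℝ → ℝ → ℝ → ℝ)
    (hZs : ∀ b x a : ℝ, Zs b x a =
      Zql (x - a) - lam * ∫ z in b..x, Wq (x - z) * Zql (z - a)) :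
    ∀ a b c : ℝ, a < b → b < c →
      (∫ y in b..c, Wql (c - y) * Zs b y a) = (Zql (c - a) - Zs b c a) / lam := by
  intro a b c _ hbc
  have hf := continuous_comp_max_zero hWqlc
  have hg := continuous_comp_max_zero hWqc
  have hZ : Continuous Zql := by
    have hprim : Continuous fun x : ℝ => ∫ y in (0:ℝ)..x, Wql (max y 0) :=
      intervalIntegral.continuous_primitive (fun _ _ => hf.intervalIntegrable _ _) 0
    have hZ' : Zql = fun x => 1 + (q + lam) * ∫ y in (0:ℝ)..(max x 0), Wql (max y 0) := by
      ext x
      rw [hZql]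
      congr 2
      refine intervalIntegral.integral_congr fun y hy => ?_
      rw [uIcc_of_le (le_max_right x 0)] at hy
      simp only [max_eq_left hy.1]
    rw [hZ']
    exact continuous_const.add (continuous_const.mul (hprim.comp (by fun_prop)))
  have hW : ∀ y : ℝ, b ≤ y → (∫ z in b..y, Wq (max (y - z) 0) * Zql (z - a)) =
      ∫ z in b..y, Wq (y - z) * Zql (z - a) := fun y hy => by
    refine intervalIntegral.integral_congr fun z hz => ?_
    rw [uIcc_of_le hy] at hz
    simp only [max_eq_left (sub_nonneg.2 hz.2)]
  have key := integral_resolvent_conv (l := lam) (b := b) (c := c) hf hg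
    (h := fun z => Zql (z - a)) (by fun_prop) (fun x hx => by
      rw [max_eq_left hx, ← hconvW x hx]
      congr 1
      refine intervalIntegral.integral_congr fun u hu => ?_
      rw [uIcc_of_le hx] at hu
      simp only [max_eq_left hu.1, max_eq_left (sub_nonneg.2 hu.2)]) hbc.le
  rw [hW c hbc.le] at key
  rw [hZs b c a, sub_sub_cancel, mul_div_cancel_left₀ _ hlam.ne', ← key]
  refine intervalIntegral.integral_congr fun y hy => ?_
  rw [uIcc_of_le hbc.le] at hy
  simp only [hZs, max_eq_left (sub_nonneg.2 hy.2), hW y hy.1]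
end

section
/- Let q, λ > 0 and 0 < Φ_q < Φ_{q+λ}. Let W : ℝ → ℝ vanish on (−∞, 0), be continuous, nonnegative and locally integrable on [0, ∞), and suppose e^{−Φ_{q+λ} x} W(x) converges to a finite strictly positive limit as x → ∞. Define Z(x) := 1 + (q+λ) ∫₀^{max(x,0)} W(y) dy and Θ(x) := 1 + λ ∫₀^x e^{−Φ_q y} W(y) dy. Then lim_{x→∞} e^{−Φ_q x} Z(x)/Θ(x) = ((λ + q)/λ) · (Φ_{q+λ} − Φ_q)/Φ_{q+λ}. -/
open MeasureTheory Filter Set Real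

/-- A continuous function on `[0, ∞)` with a limit at infinity is bounded. -/
lemma exists_norm_bound_of_continuousOn_Ici_of_tendsto {h : ℝ → ℝ} {L : ℝ}
    (hc : ContinuousOn h (Ici 0)) (hL : Tendsto h atTop (nhds L)) :
    ∃ M, ∀ x, 0 ≤ x → ‖h x‖ ≤ M := by
  obtain ⟨T, hT⟩ := eventually_atTop.1 (hL.norm.eventually (eventually_le_nhds (lt_add_one ‖L‖)))
  obtain ⟨C, hC⟩ := (isCompact_Icc (a := (0 : ℝ)) (b := T)).exists_bound_of_continuousOn
    (hc.mono Icc_subset_Ici_self)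
  refine ⟨max C (‖L‖ + 1), fun x hx => ?_⟩
  rcases le_total x T with h' | h'
  · exact (hC x ⟨hx, h'⟩).trans (le_max_left _ _)
  · exact (hT x h').trans (le_max_right _ _)

/-- If `e^{-cx} g(x)` converges to `L`, where `c > 0`, then `e^{-cx} ∫₀ˣ g` converges to `L / c`. -/
lemma tendsto_exp_mul_integral {g : ℝ → ℝ} {c L : ℝ} (hc : 0 < c)
    (hg : ContinuousOn g (Ici 0))
    (hL : Tendsto (fun x => exp (-c * x) * g x) atTop (nhds L)) :
    Tendsto (fun x => exp (-c * x) * ∫ y in (0 : ℝ)..x, g y) atTop (nhds (L / c)) := by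
  have hcont : ContinuousOn (fun x => exp (-c * x) * g x) (Ici 0) :=
    (by fun_prop : Continuous fun x => exp (-c * x)).continuousOn.mul hg
  obtain ⟨M, hM⟩ := exists_norm_bound_of_continuousOn_Ici_of_tendsto hcont hL
  set h : ℝ → ℝ := fun x => exp (-c * x) * g x with hh
  let F : ℝ → ℝ → ℝ := fun x => (Iic x).indicator fun u => exp (-c * u) * h (x - u)
  have hint : IntegrableOn (fun u => exp (-c * u)) (Ioi 0) :=
    integrableOn_exp_mul_Ioi (by linarith) 0
  have hlim : Tendsto (fun x => ∫ u in Ioi (0 : ℝ), F x u) atTop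
      (nhds (∫ u in Ioi (0 : ℝ), exp (-c * u) * L)) := by
    refine tendsto_integral_filter_of_dominated_convergence (fun u => exp (-c * u) * M) ?_ ?_
      (hint.mul_const M) ?_
    · refine Eventually.of_forall fun x => ?_
      refine (aestronglyMeasurable_indicator_iff measurableSet_Iic).2 ?_
      rw [Measure.restrict_restrict measurableSet_Iic]
      refine ContinuousOn.aestronglyMeasurable ?_ (measurableSet_Iic.inter measurableSet_Ioi)
      refine (by fun_prop : Continuous fun u => exp (-c * u)).continuousOn.mul ?_
      exact hcont.comp (by fun_prop) fun u hu => mem_Ici.2 (sub_nonneg.2 hu.1)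
    · refine Eventually.of_forall fun x => Eventually.of_forall fun u => ?_
      have hM0 : 0 ≤ M := (norm_nonneg _).trans (hM 0 le_rfl)
      by_cases hu : u ∈ Iic x
      · simp only [F, indicator_of_mem hu, norm_mul, norm_of_nonneg (exp_pos _).le]
        exact mul_le_mul_of_nonneg_left (hM _ (sub_nonneg.2 hu)) (exp_pos _).le
      · simp only [F, indicator_of_notMem hu, norm_zero]
        positivity
    · refine Eventually.of_forall fun u => ?_
      have ht : Tendsto (fun x => exp (-c * u) * h (x - u)) atTop (nhds (exp (-c * u) * L)) :=
        (hL.comp (tendsto_atTop_add_const_right _ (-u) tendsto_id)).const_mul _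
      refine ht.congr' ?_
      filter_upwards [eventually_ge_atTop u] with x hx
      simp only [F, indicator_of_mem (mem_Iic.2 hx)]
  have hval : ∫ u in Ioi (0 : ℝ), exp (-c * u) * L = L / c := by
    rw [integral_mul_const, integral_exp_mul_Ioi (by linarith)]
    simp only [mul_zero, exp_zero]
    field_simp
  rw [hval] at hlim
  refine hlim.congr' ?_
  filter_upwards [eventually_ge_atTop 0] with x hx
  have hsub := intervalIntegral.integral_comp_sub_left (a := 0) (b := x) g x
  rw [sub_self, sub_zero] at hsub
  rw [setIntegral_indicator measurableSet_Iic, Ioi_inter_Iic,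
    ← intervalIntegral.integral_of_le hx, ← hsub, ← intervalIntegral.integral_const_mul]
  congr 1 with u
  rw [hh, ← mul_assoc, ← exp_add]
  ring_nf



/-- The limit (second case misc 2) of the paper:
`lim_{x→∞} e^{-Φ_q x} Z(x)/Θ(x) = ((λ+q)/λ) (Φ_{q+λ} - Φ_q)/Φ_{q+λ}`. -/
theorem expZ_over_Theta_limit
    (q lam Phiq Phiql : ℝ) (hq : 0 < q) (hlam : 0 < lam)
    (hPhiq : 0 < Phiq) (hPhi : Phiq < Phiql)
    (W : ℝ → ℝ)
    (hW0 : ∀ x < (0:ℝ), W x = 0)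
    (hWc : ContinuousOn W (Set.Ici 0))
    (hWnn : ∀ x : ℝ, 0 ≤ x → 0 ≤ W x)
    (hWi : LocallyIntegrableOn W (Set.Ici 0))
    (hWasymp : ∃ L : ℝ, 0 < L ∧
      Filter.Tendsto (fun x => Real.exp (-Phiql * x) * W x) Filter.atTop (nhds L))
    (Z : ℝ → ℝ)
    (hZ : ∀ x : ℝ, Z x = 1 + (q + lam) * ∫ y in (0:ℝ)..(max x 0), W y)
    (Θ : ℝ → ℝ)
    (hΘ : ∀ x : ℝ, Θ x = 1 + lam * ∫ y in (0:ℝ)..x, Real.exp (-Phiq * y) * W y) :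
    Filter.Tendsto (fun x => Real.exp (-Phiq * x) * Z x / Θ x) Filter.atTop
      (nhds ((lam + q) / lam * ((Phiql - Phiq) / Phiql))) := by
  obtain ⟨L, hLpos, hL⟩ := hWasymp
  have hPhiql : 0 < Phiql := hPhiq.trans hPhi
  have hdecay : ∀ c : ℝ, 0 < c → Tendsto (fun x => exp (-c * x)) atTop (nhds 0) := fun c hc =>
    tendsto_exp_atBot.comp (tendsto_id.const_mul_atTop_of_neg (neg_lt_zero.2 hc))
  have hIZ := tendsto_exp_mul_integral hPhiql hWc hL
  have hIΘ := tendsto_exp_mul_integral (g := fun y => exp (-Phiq * y) * W y) (c := Phiql - Phiq)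
    (L := L) (sub_pos.2 hPhi)
    ((by fun_prop : Continuous fun y => exp (-Phiq * y)).continuousOn.mul hWc)
    (hL.congr fun x => by rw [← mul_assoc, ← exp_add]; ring_nf)
  have hnum := (hdecay Phiql hPhiql).add (hIZ.const_mul (q + lam))
  have hden := (hdecay (Phiql - Phiq) (sub_pos.2 hPhi)).add (hIΘ.const_mul lam)
  have hgap : Phiql - Phiq ≠ 0 := (sub_pos.2 hPhi).ne'
  have hlimit : (0 + (q + lam) * (L / Phiql)) / (0 + lam * (L / (Phiql - Phiq))) =
      (lam + q) / lam * ((Phiql - Phiq) / Phiql) := by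
    field_simp
    ring
  have hquot := hnum.div hden (by
    rw [zero_add]
    exact mul_ne_zero hlam.ne' (div_ne_zero hLpos.ne' hgap))
  rw [hlimit] at hquot
  refine hquot.congr' ?_
  filter_upwards [eventually_ge_atTop 0] with x hx
  have hexp : exp (-Phiql * x) = exp (-(Phiql - Phiq) * x) * exp (-Phiq * x) := by
    rw [← exp_add]
    ring_nf
  rw [Pi.div_apply, hZ, hΘ, max_eq_left hx, hexp,
    ← mul_div_mul_left (exp (-Phiq * x) * _) _ (exp_ne_zero (-(Phiql - Phiq) * x))]
  congr 1 <;> ring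
end

section
/- Under the standing hypotheses on q, λ, Φ_q, Φ_{q+λ}, W, f, K_c, K_p listed in the context, the following hold: (i) for every a ∈ ℝ, lim_{b↓a} Γ(a, b) = Γ₁(a); (ii) for every a ∈ ℝ, lim_{b→∞} Γ(a, b)/Θ(b − a) = Γ₂(a); (iii) the functions Γ₁ and Γ₂ are continuous and strictly increasing on (−∞, ā̄]. -/
open MeasureTheory Filter Set Real

noncomputable section

/-- Tilted inventory-cost derivative integrand against the scale function:
`ρ_a(b) = ∫_a^b g(y) W(b - y) dy`. -/
def rho (W g : ℝ → ℝ) (a b : ℝ) : ℝ :=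
  ∫ y in a..b, g y * W (b - y)

/-- `Γ(a, b)` of the paper (display (Gamma)). -/
def Gam (lam Phiq Kp Kc : ℝ) (W g : ℝ → ℝ) (a b : ℝ) : ℝ :=
  (∫ y in Set.Ioi (0:ℝ), Real.exp (-Phiq * y) * g (y + a)) +
    lam * (∫ y in (0:ℝ)..(b - a), Real.exp (-Phiq * y) * rho W g a (y + a)) +
    lam / Phiq * Real.exp (-Phiq * (b - a)) * (Kp - Kc)

/-- `Γ₁(a) = Γ(a, a+)`. -/
def Gam1 (lam Phiq Kp Kc : ℝ) (g : ℝ → ℝ) (a : ℝ) : ℝ :=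
  (∫ y in Set.Ioi (0:ℝ), Real.exp (-Phiq * y) * g (y + a)) + lam / Phiq * (Kp - Kc)

/-- `Γ₂(a) = lim_{b→∞} Γ(a,b)/Θ(b-a)`. -/
def Gam2 (Phiql : ℝ) (g : ℝ → ℝ) (a : ℝ) : ℝ :=
  ∫ y in Set.Ioi (0:ℝ), Real.exp (-Phiql * y) * g (y + a)

/-- `Θ(x) = Θ^{(q+λ)}(x, Φ(q))`. -/
def Theta (lam Phiq : ℝ) (W : ℝ → ℝ) (x : ℝ) : ℝ :=
  1 + lam * (∫ y in (0:ℝ)..x, Real.exp (-Phiq * y) * W y)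

/-- `γ(a,b) = -ρ_a(b) + K_p - K_c`. -/
def gam (Kp Kc : ℝ) (W g : ℝ → ℝ) (a b : ℝ) : ℝ :=
  -(rho W g a b) + Kp - Kc

/-- `Z(x) = Z^{(q+λ)}(x) = 1 + (q+λ)∫₀^{x ∨ 0} W(y) dy`. -/
def Zfun (q lam : ℝ) (W : ℝ → ℝ) (x : ℝ) : ℝ :=
  1 + (q + lam) * (∫ y in (0:ℝ)..(max x 0), W y)

/-- Second scale function `Ẑ(x) = Z^{(q+λ)}(x, Φ(q))`. -/
def Zhat (lam Phiq : ℝ) (W : ℝ → ℝ) (x : ℝ) : ℝ :=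
  Real.exp (Phiq * x) *
    (1 + lam * (∫ z in (0:ℝ)..(max x 0), Real.exp (-Phiq * z) * W z))

theorem isBigO_const_exp_mul_atTop (c : ℝ) {ε : ℝ} (hε : 0 < ε) :
    (fun _ : ℝ => c) =O[atTop] fun x => exp (ε * x) := by
  refine Asymptotics.IsBigO.of_bound |c| ?_
  filter_upwards [eventually_ge_atTop 0] with x hx
  rw [norm_of_nonneg (exp_pos _).le]
  exact le_mul_of_one_le_right (abs_nonneg c) (one_le_exp (mul_nonneg hε.le hx))

theorem ConvexOn.monotone_of_hasDerivWithinAt_Ici {f f' : ℝ → ℝ} (hf : ConvexOn ℝ univ f)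
    (hf' : ∀ x, HasDerivWithinAt f (f' x) (Ici x) x) : Monotone f' := by
  have h := hf.monotoneOn_rightDeriv
  have he : (fun x => derivWithin f (Ioi x) x) = f' := funext fun x =>
    ((hf' x).mono Ioi_subset_Ici_self).derivWithin (uniqueDiffWithinAt_Ioi x)
  rw [he, interior_univ] at h
  exact monotoneOn_univ.mp h

/-- The right derivative of a convex function of polynomial growth is subexponential. -/
theorem ConvexOn.isBigO_exp_of_hasDerivWithinAt_Ici {f f' : ℝ → ℝ} (hf : ConvexOn ℝ univ f)
    (hf' : ∀ x, HasDerivWithinAt f (f' x) (Ici x) x) {N : ℕ}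
    (hN : f =O[atTop] fun x => x ^ N) {ε : ℝ} (hε : 0 < ε) :
    f' =O[atTop] fun x => exp (ε * x) := by
  have hfe : f =O[atTop] fun x => exp (ε * x) :=
    hN.trans (isLittleO_pow_exp_pos_mul_atTop N hε).isBigO
  have hfs : (fun x => f (x + 1)) =O[atTop] fun x => exp (ε * x) := by
    refine (hfe.comp_tendsto (tendsto_atTop_add_const_right atTop (1 : ℝ) tendsto_id)).trans ?_
    have : ((fun x => exp (ε * x)) ∘ fun x : ℝ => id x + 1) =
        fun x => exp ε * exp (ε * x) := by
      funext x
      simp only [Function.comp_apply, id, ← exp_add]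
      ring_nf
    rw [this]
    exact Asymptotics.isBigO_const_mul_self _ _ _
  have hc := isBigO_const_exp_mul_atTop (f' 0) hε
  refine Asymptotics.IsBigO.trans (Asymptotics.IsBigO.of_bound 1 ?_)
    ((hfs.sub hfe).norm_left.add hc.norm_left)
  filter_upwards [eventually_ge_atTop 0] with x hx
  have h1 := hf.monotone_of_hasDerivWithinAt_Ici hf' hx
  have h2 := hf.le_slope_of_hasDerivWithinAt_Ioi (mem_univ x) (mem_univ (x + 1))
    (lt_add_one x) ((hf' x).mono Ioi_subset_Ici_self)
  rw [slope_def_field, add_sub_cancel_left, div_one] at h2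
  rw [one_mul, norm_of_nonneg (by positivity : 0 ≤ ‖f (x + 1) - f x‖ + ‖f' 0‖)]
  simp only [norm_eq_abs]
  rcases abs_cases (f' x) with h | h <;>
    linarith [le_abs_self (f (x + 1) - f x), neg_abs_le (f' 0),
      abs_nonneg (f (x + 1) - f x), abs_nonneg (f' 0)]

section LaplaceShift

variable {g : ℝ → ℝ} {Φ : ℝ}

theorem integrableOn_exp_mul_shift (hg : Monotone g)
    (hgO : ∀ ε > 0, g =O[atTop] fun x => exp (ε * x)) (hΦ : 0 < Φ) (a : ℝ) :
    IntegrableOn (fun y => exp (-Φ * y) * g (y + a)) (Ioi 0) := by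
  have hmono : Monotone fun y => g (y + a) := fun x y h => hg (by linarith)
  have hloc : LocallyIntegrable (fun y => exp (-Φ * y) * g (y + a)) volume :=
    (hmono.locallyIntegrable (μ := volume)).continuous_smul (𝕜 := ℝ)
      (g := fun y => exp (-Φ * y)) (by fun_prop)
  refine ((hloc.locallyIntegrableOn (Ici 0)).integrableOn_of_isBigO_atTop
    (g := fun x => exp (-(Φ / 2) * x)) ?_
    ⟨Ioi 0, Ioi_mem_atTop 0, exp_neg_integrableOn_Ioi 0 (half_pos hΦ)⟩).mono_set Ioi_subset_Ici_self
  have h := (hgO (Φ / 2) (half_pos hΦ)).comp_tendsto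
    (tendsto_atTop_add_const_right atTop a tendsto_id)
  refine ((Asymptotics.isBigO_refl (fun x => exp (-Φ * x)) atTop).mul h).trans ?_
  have : (fun x => exp (-Φ * x) * ((fun x => exp (Φ / 2 * x)) ∘ fun x : ℝ => id x + a) x) =
      fun x => exp (Φ / 2 * a) * exp (-(Φ / 2) * x) := by
    funext x
    simp only [Function.comp_apply, id, ← exp_add]
    ring_nf
  rw [this]
  exact Asymptotics.isBigO_const_mul_self _ _ _

theorem continuous_integral_exp_mul_shift (hg : Monotone g)
    (hgO : ∀ ε > 0, g =O[atTop] fun x => exp (ε * x)) (hΦ : 0 < Φ) :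
    Continuous fun a => ∫ y in Ioi (0 : ℝ), exp (-Φ * y) * g (y + a) := by
  rw [continuous_iff_continuousAt]
  intro a
  have hint := integrableOn_exp_mul_shift hg hgO hΦ
  refine continuousAt_of_dominated (bound := fun y =>
    ‖exp (-Φ * y) * g (y + (a - 1))‖ + ‖exp (-Φ * y) * g (y + (a + 1))‖)
    (Eventually.of_forall fun b => (hint b).aestronglyMeasurable) ?_
    ((hint _).norm.add (hint _).norm) ?_
  · filter_upwards [Icc_mem_nhds (sub_one_lt a) (lt_add_one a)] with b hb
    refine Eventually.of_forall fun y => ?_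
    rw [norm_mul, norm_mul, norm_mul, ← mul_add]
    refine mul_le_mul_of_nonneg_left ?_ (norm_nonneg _)
    simp only [norm_eq_abs]
    have h1 : g (y + (a - 1)) ≤ g (y + b) := hg (by linarith [hb.1])
    have h2 : g (y + b) ≤ g (y + (a + 1)) := hg (by linarith [hb.2])
    exact abs_le.mpr ⟨by linarith [neg_abs_le (g (y + (a - 1))), abs_nonneg (g (y + (a + 1)))],
      by linarith [le_abs_self (g (y + (a + 1))), abs_nonneg (g (y + (a - 1)))]⟩
  · have hcount : {y | ¬ ContinuousAt g (y + a)}.Countable :=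
      hg.countable_not_continuousAt.preimage (add_left_injective a)
    refine ae_restrict_of_ae ?_
    filter_upwards [hcount.ae_notMem volume] with y hy
    have hy' : ContinuousAt g (y + a) := not_not.mp hy
    exact continuousAt_const.mul
      (ContinuousAt.comp (f := fun b => y + b) hy' (by fun_prop))

/-- The shifted Laplace transform of a monotone function is strictly increasing as long as the
function still increases to the right of every shift. -/
theorem strictMonoOn_integral_exp_mul_shift (hg : Monotone g)
    (hgO : ∀ ε > 0, g =O[atTop] fun x => exp (ε * x)) (hΦ : 0 < Φ) {s : ℝ}
    (hs : ∀ x < s, ∃ z, g x < g z) :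
    StrictMonoOn (fun a => ∫ y in Ioi (0 : ℝ), exp (-Φ * y) * g (y + a)) (Iic s) := by
  intro a _ a' ha' haa'
  have hint := integrableOn_exp_mul_shift hg hgO hΦ
  have hle : ∀ y, exp (-Φ * y) * g (y + a) ≤ exp (-Φ * y) * g (y + a') := fun y =>
    mul_le_mul_of_nonneg_left (hg (by linarith)) (exp_pos _).le
  refine lt_of_le_of_ne (integral_mono (hint a) (hint a') hle) fun heq => ?_
  have hae := (integral_eq_iff_of_ae_le (hint a) (hint a') (Eventually.of_forall hle)).mp heq
  have hae' : ∀ᵐ y : ℝ, 0 < y → g (y + a) = g (y + a') := by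
    filter_upwards [(ae_restrict_iff' measurableSet_Ioi).mp hae] with y hy hy0
    exact mul_left_cancel₀ (exp_ne_zero _) (hy hy0)
  have hshift : ∀ᵐ y : ℝ, ∀ n : ℕ, 0 < y + n * (a' - a) →
      g (y + n * (a' - a) + a) = g (y + n * (a' - a) + a') :=
    ae_all_iff.mpr fun n => (measurePreserving_add_right volume
      ((n : ℝ) * (a' - a))).quasiMeasurePreserving.ae hae'
  have has : 0 < s - a := sub_pos.mpr (haa'.trans_le ha')
  obtain ⟨y, hy, hy0, hys⟩ : ∃ y, (∀ n : ℕ, 0 < y + n * (a' - a) →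
      g (y + n * (a' - a) + a) = g (y + n * (a' - a) + a')) ∧ 0 < y ∧ y < s - a := by
    by_contra! hno
    have hsub : Ioo 0 (s - a) ⊆ {y : ℝ | ¬ ∀ n : ℕ, 0 < y + n * (a' - a) →
        g (y + n * (a' - a) + a) = g (y + n * (a' - a) + a')} :=
      fun y hy hP => (hno y hP hy.1).not_gt hy.2
    have h0 := measure_mono_null hsub hshift
    rw [Real.volume_Ioo, ENNReal.ofReal_eq_zero] at h0
    linarith
  have hd : 0 < a' - a := sub_pos.mpr haa'
  have hconst : ∀ n : ℕ, g (y + n * (a' - a) + a) = g (y + a) := by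
    intro n
    induction n with
    | zero => simp
    | succ n ih =>
      rw [← ih, hy n (by positivity)]
      push_cast
      ring_nf
  obtain ⟨z, hz⟩ := hs (y + a) (by linarith)
  obtain ⟨n, hn⟩ := exists_nat_ge ((z - (y + a)) / (a' - a))
  rw [div_le_iff₀ hd] at hn
  have := hg (show z ≤ y + n * (a' - a) + a by linarith)
  rw [hconst n] at this
  exact this.not_gt hz

end LaplaceShift

section HalfLineConvolution

variable {k w : ℝ → ℝ} {C : ℝ}

theorem measurable_setIntegral_mul_comp_sub (hk : IntegrableOn k (Ioi 0)) (hw : Measurable w) :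
    Measurable fun x => ∫ u in Ioi (0 : ℝ), k u * w (x - u) := by
  obtain ⟨k', hk', hkk'⟩ := hk.aestronglyMeasurable
  have h : (fun x => ∫ u in Ioi (0 : ℝ), k u * w (x - u)) =
      fun x => ∫ u in Ioi (0 : ℝ), k' u * w (x - u) := funext fun x =>
    integral_congr_ae (hkk'.mono fun u hu => by simp only [hu])
  rw [h]
  refine (StronglyMeasurable.integral_prod_right ?_).measurable
  exact ((hk'.measurable.comp measurable_snd).mul
    (hw.comp (measurable_fst.sub measurable_snd))).stronglyMeasurable

theorem abs_setIntegral_mul_comp_sub_le (hk : IntegrableOn k (Ioi 0)) (hC : ∀ x, |w x| ≤ C)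
    (x : ℝ) : |∫ u in Ioi (0 : ℝ), k u * w (x - u)| ≤ ∫ u in Ioi (0 : ℝ), |k u| * C := by
  rw [← norm_eq_abs]
  refine norm_integral_le_of_norm_le (hk.norm.mul_const C) (Eventually.of_forall fun u => ?_)
  rw [norm_mul]
  exact mul_le_mul_of_nonneg_left (hC _) (norm_nonneg _)

theorem tendsto_setIntegral_mul_comp_sub (hk : IntegrableOn k (Ioi 0)) (hw : Measurable w)
    (hC : ∀ x, |w x| ≤ C) {L : ℝ} (hL : Tendsto w atTop (nhds L)) :
    Tendsto (fun x => ∫ u in Ioi (0 : ℝ), k u * w (x - u)) atTop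
      (nhds ((∫ u in Ioi (0 : ℝ), k u) * L)) := by
  rw [← integral_mul_const]
  refine tendsto_integral_filter_of_dominated_convergence (fun u => |k u| * C)
    (Eventually.of_forall fun x => ?_) (Eventually.of_forall fun x => Eventually.of_forall
      fun u => ?_) (hk.norm.mul_const C) (Eventually.of_forall fun u => ?_)
  · exact hk.aestronglyMeasurable.mul
      (hw.comp (measurable_const.sub measurable_id)).aestronglyMeasurable
  · rw [norm_mul]
    exact mul_le_mul_of_nonneg_left (hC _) (norm_nonneg _)
  · exact (hL.comp (tendsto_atTop_add_const_right atTop (-u) tendsto_id)).const_mul (k u)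

theorem setIntegral_mul_comp_sub_eq (hw0 : ∀ x < 0, w x = 0) {x : ℝ} (hx : 0 ≤ x) :
    ∫ u in Ioi (0 : ℝ), k u * w (x - u) = ∫ u in (0 : ℝ)..x, k u * w (x - u) := by
  rw [intervalIntegral.integral_of_le hx]
  refine setIntegral_eq_of_subset_of_forall_sdiff_eq_zero measurableSet_Ioi
    Ioc_subset_Ioi_self fun u hu => ?_
  have : x < u := by
    by_contra! h
    exact hu.2 ⟨hu.1, h⟩
  rw [hw0 _ (by linarith), mul_zero]

theorem setIntegral_mul_comp_sub_of_neg (hw0 : ∀ x < 0, w x = 0) {x : ℝ} (hx : x < 0) :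
    ∫ u in Ioi (0 : ℝ), k u * w (x - u) = 0 :=
  setIntegral_eq_zero_of_forall_eq_zero fun u (hu : 0 < u) => by
    rw [hw0 _ (by linarith), mul_zero]

/-- Exponential averages of a bounded function converge to its limit, up to the rate. -/
theorem tendsto_exp_mul_integral_exp_mul (hw : Measurable w) (hw0 : ∀ x < 0, w x = 0)
    (hC : ∀ x, |w x| ≤ C) {L : ℝ} (hL : Tendsto w atTop (nhds L)) {δ : ℝ} (hδ : 0 < δ) :
    Tendsto (fun x => exp (-δ * x) * ∫ y in (0 : ℝ)..x, exp (δ * y) * w y) atTop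
      (nhds (1 / δ * L)) := by
  have h := tendsto_setIntegral_mul_comp_sub (exp_neg_integrableOn_Ioi 0 hδ) hw hC hL
  rw [integral_exp_mul_Ioi (neg_lt_zero.mpr hδ)] at h
  have hc : -exp (-δ * 0) / -δ = 1 / δ := by simp
  rw [hc] at h
  refine h.congr' ?_
  filter_upwards [eventually_ge_atTop 0] with x hx
  rw [setIntegral_mul_comp_sub_eq hw0 hx, ← intervalIntegral.integral_const_mul]
  have hsub := intervalIntegral.integral_comp_sub_left (a := 0) (b := x)
    (fun y => exp (-δ * x) * (exp (δ * y) * w y)) x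
  rw [sub_self, sub_zero] at hsub
  rw [← hsub]
  refine intervalIntegral.integral_congr fun u _ => ?_
  simp only [← mul_assoc, ← exp_add]
  ring_nf

end HalfLineConvolution

theorem measurable_of_continuousOn_Ici {W : ℝ → ℝ} (hW0 : ∀ x < 0, W x = 0)
    (hW : ContinuousOn W (Ici 0)) : Measurable W := by
  classical
  have h : (Ici (0 : ℝ)).piecewise W (fun _ => 0) = W := by
    funext x
    by_cases hx : x ∈ Ici (0 : ℝ)
    · rw [piecewise_eq_of_mem _ _ _ hx]
    · rw [piecewise_eq_of_notMem _ _ _ hx, hW0 x (not_le.mp hx)]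
  rw [← h]
  exact hW.measurable_piecewise continuousOn_const measurableSet_Ici

theorem exists_bound_exp_neg_mul {W : ℝ → ℝ} {Φ L : ℝ} (hΦ : 0 < Φ) (hW0 : ∀ x < 0, W x = 0)
    (hWnn : ∀ x ≥ 0, 0 ≤ W x) (hW : MonotoneOn W (Ici 0))
    (hL : Tendsto (fun x => exp (-Φ * x) * W x) atTop (nhds L)) :
    ∃ C, ∀ x, |exp (-Φ * x) * W x| ≤ C := by
  obtain ⟨x₀, hx₀⟩ := eventually_atTop.mp (hL.abs.eventually_le_const (lt_add_one |L|))
  have hm : 0 ≤ W (max x₀ 0) := hWnn _ (le_max_right _ _)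
  refine ⟨|L| + 1 + W (max x₀ 0), fun x => ?_⟩
  rcases le_total x₀ x with hx | hx
  · linarith [hx₀ x hx]
  · rcases lt_or_ge x 0 with h0 | h0
    · rw [hW0 x h0, mul_zero, abs_zero]
      positivity
    · have h1 : W x ≤ W (max x₀ 0) := hW h0 (le_max_right x₀ 0) (le_max_of_le_left hx)
      have h2 : exp (-Φ * x) ≤ 1 := exp_le_one_iff.mpr (by nlinarith)
      rw [abs_of_nonneg (mul_nonneg (exp_pos _).le (hWnn x h0))]
      nlinarith [hWnn x h0, abs_nonneg L]

theorem rho_add_eq {W g : ℝ → ℝ} {Φ : ℝ} (hW0 : ∀ x < 0, W x = 0) (a : ℝ) {y : ℝ} (hy : 0 ≤ y) :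
    rho W g a (y + a) = exp (Φ * y) * ∫ u in Ioi (0 : ℝ),
      exp (-Φ * u) * g (u + a) * (exp (-Φ * (y - u)) * W (y - u)) := by
  rw [setIntegral_mul_comp_sub_eq (k := fun u => exp (-Φ * u) * g (u + a))
    (w := fun x => exp (-Φ * x) * W x) (fun x hx => by simp only [hW0 x hx, mul_zero]) hy,
    ← intervalIntegral.integral_const_mul, rho]
  have hsub := intervalIntegral.integral_comp_add_right (a := 0) (b := y)
    (fun v => g v * W (y + a - v)) a
  rw [zero_add] at hsub
  rw [← hsub]
  refine intervalIntegral.integral_congr fun u _ => ?_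
  have he : exp (Φ * y) * (exp (-Φ * u) * exp (-Φ * (y - u))) = 1 := by
    rw [← exp_add, ← exp_add, exp_eq_one_iff]
    ring
  simp only [add_sub_add_right_eq_sub]
  linear_combination (-(g (u + a) * W (y - u))) * he

theorem tendsto_Gam_nhdsGT {lam Phiq Kp Kc : ℝ} {W g : ℝ → ℝ} (hPhiq : 0 < Phiq)
    (hWnn : ∀ x ≥ 0, 0 ≤ W x) (hW : MonotoneOn W (Ici 0)) (hg : Monotone g) (a : ℝ) :
    Tendsto (fun b => Gam lam Phiq Kp Kc W g a b) (nhdsWithin a (Ioi a))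
      (nhds (Gam1 lam Phiq Kp Kc g a)) := by
  set G := |g a| + |g (a + 1)|
  have hrho : ∀ y ∈ Icc (0 : ℝ) 1, ‖rho W g a (y + a)‖ ≤ G * W 1 := by
    intro y hy
    have hG : 0 ≤ G * W 1 := mul_nonneg (by positivity) (hWnn 1 zero_le_one)
    have h := intervalIntegral.norm_integral_le_of_norm_le_const (a := a) (b := y + a)
      (f := fun v => g v * W (y + a - v)) (C := G * W 1) fun v hv => by
        rw [uIoc_of_le (by linarith [hy.1])] at hv
        have h1 : 0 ≤ y + a - v := by linarith [hv.2]
        have h2 : W (y + a - v) ≤ W 1 :=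
          hW h1 (mem_Ici.mpr zero_le_one) (by linarith [hv.1, hy.2])
        have h3 : g a ≤ g v := hg hv.1.le
        have h4 : g v ≤ g (a + 1) := hg (by linarith [hv.2, hy.2])
        rw [norm_mul]
        refine mul_le_mul ?_ ?_ (norm_nonneg _) (by positivity)
        · exact abs_le.mpr ⟨by linarith [neg_abs_le (g a), abs_nonneg (g (a + 1))],
            by linarith [le_abs_self (g (a + 1)), abs_nonneg (g a)]⟩
        · rwa [norm_of_nonneg (hWnn _ h1)]
    refine h.trans ?_
    rw [add_sub_cancel_right, abs_of_nonneg hy.1]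
    exact mul_le_of_le_one_right hG hy.2
  have hmid : Tendsto (fun b => ∫ y in (0 : ℝ)..(b - a), exp (-Phiq * y) * rho W g a (y + a))
      (nhdsWithin a (Ioi a)) (nhds 0) := by
    refine squeeze_zero_norm' (a := fun b => G * W 1 * |b - a - 0|) ?_ ?_
    · filter_upwards [Ioo_mem_nhdsGT (lt_add_one a)] with b hb
      refine intervalIntegral.norm_integral_le_of_norm_le_const fun y hy => ?_
      rw [uIoc_of_le (by linarith [hb.1])] at hy
      rw [norm_mul, norm_of_nonneg (exp_pos _).le]
      refine (mul_le_of_le_one_left (norm_nonneg _) (exp_le_one_iff.mpr ?_)).trans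
        (hrho y ⟨hy.1.le, by linarith [hy.2, hb.2]⟩)
      nlinarith [hy.1]
    · refine tendsto_nhdsWithin_of_tendsto_nhds ?_
      have : Continuous fun b => G * W 1 * |b - a - 0| := by fun_prop
      simpa using this.tendsto a
  have hlast : Tendsto (fun b => lam / Phiq * exp (-Phiq * (b - a)) * (Kp - Kc))
      (nhdsWithin a (Ioi a)) (nhds (lam / Phiq * (Kp - Kc))) := by
    refine tendsto_nhdsWithin_of_tendsto_nhds ?_
    have : Continuous fun b => lam / Phiq * exp (-Phiq * (b - a)) * (Kp - Kc) := by fun_prop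
    simpa using this.tendsto a
  simpa only [Gam, Gam1, mul_zero, add_zero] using
    ((tendsto_const_nhds.add (hmid.const_mul lam)).add hlast)

theorem tendsto_Gam_div_Theta_atTop {lam Phiq Phiql Kp Kc : ℝ} {W g : ℝ → ℝ} (hlam : 0 < lam)
    (hPhiq : 0 < Phiq) (hPhi : Phiq < Phiql) (hW0 : ∀ x < 0, W x = 0)
    (hWnn : ∀ x ≥ 0, 0 ≤ W x) (hWcont : ContinuousOn W (Ici 0)) (hW : MonotoneOn W (Ici 0))
    {L : ℝ} (hLpos : 0 < L) (hL : Tendsto (fun x => exp (-Phiql * x) * W x) atTop (nhds L))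
    (a : ℝ) (hg : IntegrableOn (fun y => exp (-Phiql * y) * g (y + a)) (Ioi 0)) :
    Tendsto (fun b => Gam lam Phiq Kp Kc W g a b / Theta lam Phiq W (b - a)) atTop
      (nhds (Gam2 Phiql g a)) := by
  have hδ : 0 < Phiql - Phiq := sub_pos.mpr hPhi
  set δ := Phiql - Phiq with hδdef
  set w : ℝ → ℝ := fun x => exp (-Phiql * x) * W x with hwdef
  have hw : Measurable w :=
    Measurable.mul (by fun_prop) (measurable_of_continuousOn_Ici hW0 hWcont)
  have hw0 : ∀ x < 0, w x = 0 := fun x hx => by simp only [hwdef, hW0 x hx, mul_zero]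
  obtain ⟨C, hC⟩ := exists_bound_exp_neg_mul (hPhiq.trans hPhi) hW0 hWnn hW hL
  have hΘ : Tendsto (fun x => exp (-δ * x) * ∫ y in (0 : ℝ)..x, exp (-Phiq * y) * W y) atTop
      (nhds (1 / δ * L)) := by
    refine (tendsto_exp_mul_integral_exp_mul hw hw0 hC hL hδ).congr fun x => ?_
    congr 1
    refine intervalIntegral.integral_congr fun y _ => ?_
    simp only [hwdef, hδdef, ← mul_assoc, ← exp_add]
    ring_nf
  have hΓ : Tendsto (fun x => exp (-δ * x) * ∫ y in (0 : ℝ)..x,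
      exp (-Phiq * y) * rho W g a (y + a)) atTop (nhds (1 / δ * (Gam2 Phiql g a * L))) := by
    refine (tendsto_exp_mul_integral_exp_mul (measurable_setIntegral_mul_comp_sub hg hw)
      (fun x hx => setIntegral_mul_comp_sub_of_neg hw0 hx)
      (abs_setIntegral_mul_comp_sub_le hg hC)
      (tendsto_setIntegral_mul_comp_sub hg hw hC hL) hδ).congr' ?_
    filter_upwards [eventually_ge_atTop 0] with x hx
    congr 1
    refine intervalIntegral.integral_congr fun y hy => ?_
    rw [uIcc_of_le hx] at hy
    rw [rho_add_eq (Φ := Phiql) hW0 a hy.1, ← mul_assoc, ← exp_add]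
    exact congrArg (fun t => exp t * _) (by rw [hδdef]; ring)
  have hexp : Tendsto (fun x => exp (-δ * x)) atTop (nhds 0) :=
    tendsto_exp_atBot.comp (tendsto_id.const_mul_atTop_of_neg (neg_lt_zero.mpr hδ))
  have hexp' : Tendsto (fun x => exp (-Phiq * x)) atTop (nhds 0) :=
    tendsto_exp_atBot.comp (tendsto_id.const_mul_atTop_of_neg (neg_lt_zero.mpr hPhiq))
  have hnum := ((hexp.mul_const (∫ y in Ioi (0 : ℝ), exp (-Phiq * y) * g (y + a))).add
    (hΓ.const_mul lam)).add
    ((hexp.mul hexp').const_mul (lam / Phiq * (Kp - Kc)))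
  have hden := hexp.add (hΘ.const_mul lam)
  have hdiv := hnum.div hden (by positivity)
  have hlim : (0 * (∫ y in Ioi (0 : ℝ), exp (-Phiq * y) * g (y + a)) +
      lam * (1 / δ * (Gam2 Phiql g a * L)) + lam / Phiq * (Kp - Kc) * (0 * 0)) /
      (0 + lam * (1 / δ * L)) = Gam2 Phiql g a := by
    field_simp
    ring
  rw [hlim] at hdiv
  refine (hdiv.comp (tendsto_atTop_add_const_right atTop (-a) tendsto_id)).congr fun b => ?_
  simp only [Function.comp_apply, Pi.div_apply, id, ← sub_eq_add_neg]
  rw [Gam, Theta]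
  refine Eq.trans ?_ (mul_div_mul_left _ _ (exp_ne_zero (-δ * (b - a))))
  congr 1 <;> ring

/-- Lemma 5.1 (Gamma asymptotics) of the paper. -/
theorem Gamma_asymptotics
    (q lam Phiq Phiql : ℝ) (hq : 0 < q) (hlam : 0 < lam)
    (hPhiq : 0 < Phiq) (hPhi : Phiq < Phiql)
    (W : ℝ → ℝ)
    (hW0 : ∀ x < (0:ℝ), W x = 0)
    (hWnn : ∀ x ≥ (0:ℝ), 0 ≤ W x)
    (hWcont : ContinuousOn W (Set.Ici 0))
    (hWmono : StrictMonoOn W (Set.Ici 0))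
    (hWC1 : ContDiffOn ℝ 1 W (Set.Ioi 0))
    (hWratio_mono : ∀ a y : ℝ, a < y →
      MonotoneOn (fun b => W (b - y) / W (b - a)) (Set.Ioi y))
    (hWratio_lim : ∀ a y : ℝ, a < y →
      Filter.Tendsto (fun b => W (b - y) / W (b - a)) Filter.atTop
        (nhds (Real.exp (-Phiql * (y - a)))))
    (hWasymp : ∃ L : ℝ, 0 < L ∧
      Filter.Tendsto (fun x => Real.exp (-Phiql * x) * W x) Filter.atTop (nhds L))
    (f f' : ℝ → ℝ)
    (hf_conv : ConvexOn ℝ Set.univ f)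
    (hf_deriv : ∀ x : ℝ, HasDerivWithinAt f (f' x) (Set.Ici x) x)
    (hf_pw : ∃ E : Set ℝ, E.Countable ∧ ∀ x ∉ E, ContinuousAt f' x)
    (hf_growth : ∃ C M : ℝ, ∃ N : ℕ, 0 < C ∧ 0 < M ∧
      ∀ x : ℝ, M < |x| → |f x| ≤ C * |x| ^ N)
    (Kc Kp : ℝ) (hK : Kp < Kc)
    (g : ℝ → ℝ) (hg : ∀ x : ℝ, g x = f' x + q * Kc + lam * (Kc - Kp))
    (habar_ne : {a : ℝ | 0 ≤ g a}.Nonempty)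
    (habar_bdd : BddBelow {a : ℝ | 0 ≤ g a})
    (habb_ne : {a : ℝ | 0 < f' a + q * Kp}.Nonempty)
    (habb_bdd : BddBelow {a : ℝ | 0 < f' a + q * Kp})
    (abarbar : ℝ) (habarbar : abarbar = sInf {a : ℝ | 0 < f' a + q * Kp}) :
    (∀ a : ℝ, Filter.Tendsto (fun b => Gam lam Phiq Kp Kc W g a b)
        (nhdsWithin a (Set.Ioi a)) (nhds (Gam1 lam Phiq Kp Kc g a))) ∧
    (∀ a : ℝ, Filter.Tendsto
        (fun b => Gam lam Phiq Kp Kc W g a b / Theta lam Phiq W (b - a))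
        Filter.atTop (nhds (Gam2 Phiql g a))) ∧
    (ContinuousOn (Gam1 lam Phiq Kp Kc g) (Set.Iic abarbar) ∧
      StrictMonoOn (Gam1 lam Phiq Kp Kc g) (Set.Iic abarbar) ∧
      ContinuousOn (Gam2 Phiql g) (Set.Iic abarbar) ∧
      StrictMonoOn (Gam2 Phiql g) (Set.Iic abarbar)) := by
  have hf'mono := hf_conv.monotone_of_hasDerivWithinAt_Ici hf_deriv
  have hgeq : g = fun x => f' x + (q * Kc + lam * (Kc - Kp)) :=
    funext fun x => by rw [hg x, add_assoc]
  have hgmono : Monotone g := by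
    rw [hgeq]
    exact hf'mono.add_const _
  obtain ⟨C, M, N, -, -, hfb⟩ := hf_growth
  have hfO : f =O[atTop] fun x => x ^ N := by
    refine Asymptotics.IsBigO.of_bound C ?_
    filter_upwards [eventually_gt_atTop M] with x hx
    rw [norm_pow]
    exact hfb x (hx.trans_le (le_abs_self x))
  have hgO : ∀ ε > 0, g =O[atTop] fun x => exp (ε * x) := fun ε hε => by
    rw [hgeq]
    exact (hf_conv.isBigO_exp_of_hasDerivWithinAt_Ici hf_deriv hfO hε).add
      (isBigO_const_exp_mul_atTop _ hε)
  have hPhiql : 0 < Phiql := hPhiq.trans hPhi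
  have hincr : ∀ x < abarbar, ∃ z, g x < g z := fun x hx => by
    obtain ⟨z, hz⟩ := habb_ne
    rw [habarbar] at hx
    have hz' : 0 < f' z + q * Kp := hz
    have hx' : f' x + q * Kp ≤ 0 := by
      by_contra! h
      exact notMem_of_lt_csInf hx habb_bdd h
    refine ⟨z, ?_⟩
    rw [hg, hg]
    linarith
  obtain ⟨L, hLpos, hL⟩ := hWasymp
  exact ⟨fun a => tendsto_Gam_nhdsGT hPhiq hWnn hWmono.monotoneOn hgmono a,
    fun a => tendsto_Gam_div_Theta_atTop hlam hPhiq hPhi hW0 hWnn hWcont hWmono.monotoneOn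
      hLpos hL a (integrableOn_exp_mul_shift hgmono hgO hPhiql a),
    ((continuous_integral_exp_mul_shift hgmono hgO hPhiq).add continuous_const).continuousOn,
    (strictMonoOn_integral_exp_mul_shift hgmono hgO hPhiq hincr).add_const _,
    (continuous_integral_exp_mul_shift hgmono hgO hPhiql).continuousOn,
    strictMonoOn_integral_exp_mul_shift hgmono hgO hPhiql hincr⟩
end
end

section
/- Under the standing hypotheses on q, λ, Φ_q, Φ_{q+λ}, W, f, K_c, K_p listed in the context, the following hold: (i) for every a ∈ ℝ, Γ₁(a) > 0 if and only if a > ā₁; (ii) lim_{b→∞} Γ(a, b) = +∞ whenever a > ā₂, and lim_{b→∞} Γ(a, b) = −∞ whenever a < ā₂. -/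
open MeasureTheory Filter Set Real

noncomputable section

/-- The exponentially weighted tail integral of `k` over `(a, ∞)`. -/
def expTail (c : ℝ) (k : ℝ → ℝ) (a : ℝ) : ℝ :=
  ∫ y in Set.Ioi a, Real.exp (-c * y) * k y

lemma integral_exp_mul_comp_add (c : ℝ) (k : ℝ → ℝ) (a : ℝ) :
    (∫ y in Set.Ioi (0:ℝ), Real.exp (-c * y) * k (y + a)) =
      Real.exp (c * a) * expTail c k a := by
  have h := (measurePreserving_add_right (volume : Measure ℝ) a).setIntegral_preimage_emb
    (measurableEmbedding_addRight a) (fun y => Real.exp (-c * y) * k y) (Set.Ioi a)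
  rw [expTail, ← h, ← integral_const_mul]
  simp only [Set.preimage_add_const_Ioi, sub_self]
  congr 1
  ext y
  rw [← mul_assoc, ← Real.exp_add]
  ring_nf

lemma expTail_sub_const {c : ℝ} (hc : 0 < c) {k : ℝ → ℝ} {a : ℝ}
    (hint : IntegrableOn (fun y => Real.exp (-c * y) * k y) (Set.Ioi a)) (d : ℝ) :
    expTail c (fun y => k y - d) a = expTail c k a - d * Real.exp (-c * a) / c := by
  have he : IntegrableOn (fun y => Real.exp (-c * y)) (Set.Ioi a) :=
    integrableOn_exp_mul_Ioi (by linarith) a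
  simp only [expTail, mul_sub]
  rw [integral_sub hint (he.mul_const d), integral_mul_const, integral_exp_mul_Ioi (by linarith)]
  field_simp

lemma expTail_eq_add {c : ℝ} {k : ℝ → ℝ}
    (hint : ∀ a, IntegrableOn (fun y => Real.exp (-c * y) * k y) (Set.Ioi a)) (a b : ℝ) :
    expTail c k a = (∫ y in a..b, Real.exp (-c * y) * k y) + expTail c k b :=
  (intervalIntegral.integral_interval_add_Ioi (hint a) (hint b)).symm

lemma intervalIntegrable_of_integrableOn_Ioi {h : ℝ → ℝ}
    (hint : ∀ a, IntegrableOn h (Set.Ioi a)) (a b : ℝ) : IntervalIntegrable h volume a b :=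
  ⟨(hint a).mono_set Set.Ioc_subset_Ioi_self, (hint b).mono_set Set.Ioc_subset_Ioi_self⟩

lemma continuous_expTail {c : ℝ} {k : ℝ → ℝ}
    (hint : ∀ a, IntegrableOn (fun y => Real.exp (-c * y) * k y) (Set.Ioi a)) :
    Continuous (expTail c k) := by
  have h : expTail c k = fun a =>
      expTail c k 0 - ∫ y in (0:ℝ)..a, Real.exp (-c * y) * k y := by
    ext a
    rw [expTail_eq_add hint 0 a]
    ring
  rw [h]
  exact continuous_const.sub
    (intervalIntegral.continuous_primitive (intervalIntegrable_of_integrableOn_Ioi hint) 0)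

lemma expTail_pos_of_nonneg {c : ℝ} {k : ℝ → ℝ} (hk : Monotone k)
    (hint : ∀ a, IntegrableOn (fun y => Real.exp (-c * y) * k y) (Set.Ioi a))
    (hpos : ∃ x, 0 < k x) {a : ℝ} (ha : 0 ≤ k a) : 0 < expTail c k a := by
  obtain ⟨x, hx⟩ := hpos
  have hnn : 0 ≤ᵐ[volume.restrict (Set.Ioi a)] fun y => Real.exp (-c * y) * k y := by
    filter_upwards [ae_restrict_mem measurableSet_Ioi] with y hy
    exact mul_nonneg (Real.exp_pos _).le (ha.trans (hk (le_of_lt hy)))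
  rw [expTail, setIntegral_pos_iff_support_of_nonneg_ae hnn (hint a)]
  refine lt_of_lt_of_le ?_ (measure_mono (s := Set.Ioi (max a x)) ?_)
  · simp
  · intro y hy
    have hy' : max a x < y := hy
    rw [max_lt_iff] at hy'
    exact ⟨(mul_pos (Real.exp_pos _) (hx.trans_le (hk hy'.2.le))).ne', hy'.1⟩

lemma expTail_pos_of_lt {c : ℝ} {k : ℝ → ℝ} (hk : Monotone k)
    (hint : ∀ a, IntegrableOn (fun y => Real.exp (-c * y) * k y) (Set.Ioi a))
    (hpos : ∃ x, 0 < k x) {a b : ℝ} (hab : a < b) (ha : 0 ≤ expTail c k a) :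
    0 < expTail c k b := by
  rcases le_or_gt 0 (k b) with hb | hb
  · exact expTail_pos_of_nonneg hk hint hpos hb
  · have hneg : 0 < ∫ y in a..b, -(Real.exp (-c * y) * k y) := by
      refine intervalIntegral.intervalIntegral_pos_of_pos_on
        (intervalIntegrable_of_integrableOn_Ioi hint a b).neg (fun y hy => ?_) hab
      have := mul_neg_of_pos_of_neg (Real.exp_pos (-c * y)) ((hk hy.2.le).trans_lt hb)
      linarith
    rw [intervalIntegral.integral_neg] at hneg
    have := expTail_eq_add hint a b
    linarith

lemma bddBelow_expTail_nonneg {c : ℝ} (hc : 0 < c) {k : ℝ → ℝ} (hk : Monotone k)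
    (hint : ∀ a, IntegrableOn (fun y => Real.exp (-c * y) * k y) (Set.Ioi a))
    (hneg : ∃ x, k x < 0) : BddBelow {a : ℝ | 0 ≤ expTail c k a} := by
  obtain ⟨x, hx⟩ := hneg
  set m := Real.exp (-c * x) * k x with hm
  have hm0 : m < 0 := mul_neg_of_pos_of_neg (Real.exp_pos _) hx
  refine ⟨min x (x + expTail c k x / m), fun a (ha : 0 ≤ expTail c k a) => ?_⟩
  by_contra! hlt
  rw [lt_min_iff] at hlt
  have hle : (∫ y in a..x, Real.exp (-c * y) * k y) ≤ ∫ _ in a..x, m := by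
    refine intervalIntegral.integral_mono_on hlt.1.le
      (intervalIntegrable_of_integrableOn_Ioi hint a x) (by simp) fun y hy => ?_
    have h1 : Real.exp (-c * x) ≤ Real.exp (-c * y) :=
      Real.exp_le_exp.2 (by nlinarith [hy.2])
    have h2 := hk hy.2
    have h3 := Real.exp_pos (-c * y)
    rw [hm]
    nlinarith
  rw [intervalIntegral.integral_const, smul_eq_mul] at hle
  have h4 := expTail_eq_add hint a x
  have h5 : a - x < expTail c k x / m := by linarith [hlt.2]
  rw [lt_div_iff_of_neg hm0] at h5
  linarith

/-- The weighted tail integral of a monotone function that changes sign changes sign exactly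
once. -/
lemma expTail_sign {c : ℝ} (hc : 0 < c) {k : ℝ → ℝ} (hk : Monotone k)
    (hint : ∀ a, IntegrableOn (fun y => Real.exp (-c * y) * k y) (Set.Ioi a))
    (hneg : ∃ x, k x < 0) (hpos : ∃ x, 0 < k x) :
    (∀ a, 0 < expTail c k a ↔ sInf {a : ℝ | 0 ≤ expTail c k a} < a) ∧
      ∀ a < sInf {a : ℝ | 0 ≤ expTail c k a}, expTail c k a < 0 := by
  have hbdd := bddBelow_expTail_nonneg hc hk hint hneg
  refine ⟨fun a => ⟨fun ha => ?_, fun ha => ?_⟩, fun a ha => ?_⟩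
  · have hev := (continuous_expTail hint).continuousAt.eventually_const_lt ha
    obtain ⟨b, hb, hba⟩ :=
      ((hev.filter_mono nhdsWithin_le_nhds).and (self_mem_nhdsWithin (s := Set.Iio a))).exists
    exact (csInf_le hbdd (show 0 ≤ expTail c k b from hb.le)).trans_lt hba
  · obtain ⟨x, hx⟩ := hpos
    obtain ⟨b, hb, hba⟩ := exists_lt_of_csInf_lt
      ⟨x, (expTail_pos_of_nonneg hk hint ⟨x, hx⟩ hx.le).le⟩ ha
    exact expTail_pos_of_lt hk hint ⟨x, hx⟩ hba hb
  · by_contra! h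
    exact (csInf_le hbdd h).not_gt ha

lemma rightDeriv_le_sub {f f' : ℝ → ℝ} (hf : ConvexOn ℝ Set.univ f)
    (hf' : ∀ x : ℝ, HasDerivWithinAt f (f' x) (Set.Ici x) x) (x : ℝ) :
    f' x ≤ f (x + 1) - f x := by
  have h := hf.le_slope_of_hasDerivWithinAt_Ioi (mem_univ x) (mem_univ (x + 1))
    (by linarith) (hasDerivWithinAt_Ioi_iff_Ici.2 (hf' x))
  simpa [slope_def_field] using h

lemma monotone_rightDeriv {f f' : ℝ → ℝ} (hf : ConvexOn ℝ Set.univ f)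
    (hf' : ∀ x : ℝ, HasDerivWithinAt f (f' x) (Set.Ici x) x) : Monotone f' := by
  have h : f' = fun x => derivWithin f (Set.Ioi x) x := by
    ext x
    exact ((hasDerivWithinAt_Ioi_iff_Ici.2 (hf' x)).derivWithin (uniqueDiffWithinAt_Ioi x)).symm
  have hm := hf.monotoneOn_rightDeriv
  rw [interior_univ, monotoneOn_univ] at hm
  rwa [h]

lemma isBigO_exp_of_growth {f : ℝ → ℝ}
    (hf : ∃ C M : ℝ, ∃ N : ℕ, 0 < C ∧ 0 < M ∧ ∀ x : ℝ, M < |x| → |f x| ≤ C * |x| ^ N)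
    {e : ℝ} (he : 0 < e) : f =O[atTop] fun x => Real.exp (e * x) := by
  obtain ⟨C, M, N, -, hM, h⟩ := hf
  refine Asymptotics.IsBigO.trans (Asymptotics.IsBigO.of_bound C ?_)
    (isLittleO_pow_exp_pos_mul_atTop N he).isBigO
  filter_upwards [eventually_gt_atTop M] with x hx
  simpa using h x (hx.trans_le (le_abs_self x))

lemma const_isBigO_exp_mul_atTop (d : ℝ) {e : ℝ} (he : 0 < e) :
    (fun _ : ℝ => d) =O[atTop] fun x => Real.exp (e * x) := by
  refine Asymptotics.IsBigO.of_bound |d| ?_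
  filter_upwards [eventually_ge_atTop 0] with x hx
  rw [Real.norm_eq_abs, Real.norm_eq_abs, Real.abs_exp]
  exact le_mul_of_one_le_right (abs_nonneg d) (Real.one_le_exp (by positivity))

lemma rightDeriv_isBigO_exp {f f' : ℝ → ℝ} (hf : ConvexOn ℝ Set.univ f)
    (hf' : ∀ x : ℝ, HasDerivWithinAt f (f' x) (Set.Ici x) x)
    (hg : ∃ C M : ℝ, ∃ N : ℕ, 0 < C ∧ 0 < M ∧ ∀ x : ℝ, M < |x| → |f x| ≤ C * |x| ^ N)
    {e : ℝ} (he : 0 < e) : f' =O[atTop] fun x => Real.exp (e * x) := by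
  have h0 := isBigO_exp_of_growth hg he
  have h1 : (fun x => f (x + 1)) =O[atTop] fun x => Real.exp (e * x) := by
    refine (h0.comp_tendsto (tendsto_atTop_add_const_right atTop 1 tendsto_id)).trans ?_
    refine Asymptotics.IsBigO.of_bound (Real.exp e) (Eventually.of_forall fun x => ?_)
    simp [mul_add, Real.exp_add, mul_comm]
  have h2 : (fun _ => f' 0) =O[atTop] fun x => Real.exp (e * x) :=
    const_isBigO_exp_mul_atTop _ he
  have h3 := (h1.sub h0).norm_left.add h2.norm_left
  refine Asymptotics.IsBigO.trans (Asymptotics.IsBigO.of_bound 1 ?_) h3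
  filter_upwards [eventually_ge_atTop 0] with x hx
  have ha := rightDeriv_le_sub hf hf' x
  have hb := monotone_rightDeriv hf hf' hx
  rw [Real.norm_eq_abs, Real.norm_eq_abs, Real.norm_eq_abs, Real.norm_eq_abs, one_mul,
    abs_of_nonneg (a := _ + _) (by positivity), abs_le]
  have := le_abs_self (f (x + 1) - f x)
  have := neg_abs_le (f' 0)
  constructor <;> linarith [abs_nonneg (f' 0), abs_nonneg (f (x + 1) - f x)]

lemma Monotone.integrableOn_exp_mul {k : ℝ → ℝ} (hk : Monotone k) {c : ℝ} (hc : 0 < c)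
    (hO : k =O[atTop] fun x => Real.exp (c / 2 * x)) (a : ℝ) :
    IntegrableOn (fun y => Real.exp (-c * y) * k y) (Set.Ioi a) := by
  have hloc : LocallyIntegrable (fun y => Real.exp (-c * y) * k y) :=
    hk.locallyIntegrable.continuous_mul (by fun_prop)
  have hO' : (fun y => Real.exp (-c * y) * k y) =O[atTop] fun y => Real.exp (-(c / 2) * y) := by
    refine ((Asymptotics.isBigO_refl (fun y => Real.exp (-c * y)) atTop).mul hO).congr_right
      fun y => ?_
    rw [← Real.exp_add]
    ring_nf
  refine ((hloc.locallyIntegrableOn (Set.Ici a)).integrableOn_of_isBigO_atTop hO'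
    ⟨Set.Ioi a, Ioi_mem_atTop a, ?_⟩).mono_set Set.Ioi_subset_Ici_self
  exact integrableOn_exp_mul_Ioi (by linarith) a

lemma tendsto_intervalIntegral_atTop {h : ℝ → ℝ} {a : ℝ} (hc : ContinuousOn h (Set.Ici a))
    (ht : Tendsto h atTop atTop) : Tendsto (fun x => ∫ y in a..x, h y) atTop atTop := by
  have hii : ∀ s t, a ≤ s → a ≤ t → IntervalIntegrable h volume s t := fun s t hs ht =>
    (hc.mono fun y hy => (le_min hs ht).trans hy.1).intervalIntegrable
  obtain ⟨m, hm⟩ := eventually_atTop.1 (ht.eventually_ge_atTop 1)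
  set Y := max a m
  have hY : a ≤ Y := le_max_left _ _
  refine tendsto_atTop_mono' atTop ?_ (tendsto_atTop_add_const_left atTop
    ((∫ y in a..Y, h y) - Y) tendsto_id)
  filter_upwards [eventually_ge_atTop Y] with x hx
  have h1 : (∫ _ in Y..x, (1:ℝ)) ≤ ∫ y in Y..x, h y :=
    intervalIntegral.integral_mono_on hx (by simp) (hii _ _ hY (hY.trans hx))
      fun y hy => hm y ((le_max_right a m).trans hy.1)
  rw [intervalIntegral.integral_const, smul_eq_mul, mul_one] at h1
  rw [← intervalIntegral.integral_add_adjacent_intervals (hii a Y le_rfl hY)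
    (hii Y x hY (hY.trans hx))]
  simp only [id]
  linarith

/-- Exponentially damped version of `rho`. -/
lemma rho_eq_exp_mul {W g : ℝ → ℝ} (hW0 : ∀ x < (0:ℝ), W x = 0) (c : ℝ) {a b : ℝ}
    (hab : a ≤ b) :
    rho W g a b = Real.exp (c * b) * ∫ y in Set.Ioi a,
      (Real.exp (-c * y) * g y) * (Real.exp (-c * (b - y)) * W (b - y)) := by
  have h : (∫ y in Set.Ioi a,
      (Real.exp (-c * y) * g y) * (Real.exp (-c * (b - y)) * W (b - y))) =
      ∫ y in Set.Ioc a b, (Real.exp (-c * y) * g y) * (Real.exp (-c * (b - y)) * W (b - y)) := by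
    refine (setIntegral_eq_of_subset_of_forall_sdiff_eq_zero measurableSet_Ioi
      Set.Ioc_subset_Ioi_self fun y hy => ?_)
    have hy' : b < y := by
      by_contra! hcon
      exact hy.2 ⟨hy.1, hcon⟩
    rw [hW0 _ (by linarith)]
    ring
  rw [h, rho, intervalIntegral.integral_of_le hab, ← integral_const_mul]
  congr 1
  ext y
  have : Real.exp (c * b) * Real.exp (-c * y) * Real.exp (-c * (b - y)) = 1 := by
    rw [← Real.exp_add, ← Real.exp_add, Real.exp_eq_one_iff]
    ring
  linear_combination (-(g y * W (b - y))) * this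

/-- Continuity of a convolution with a bounded kernel that is continuous away from `0`. -/
lemma continuous_integral_mul_comp_sub {u v : ℝ → ℝ} {a M : ℝ}
    (hu : IntegrableOn u (Set.Ioi a)) (hv : Measurable v) (hM : ∀ x, |v x| ≤ M)
    (hc : ∀ x ≠ 0, ContinuousAt v x) :
    Continuous fun b => ∫ y in Set.Ioi a, u y * v (b - y) := by
  refine continuous_iff_continuousAt.2 fun b => ?_
  refine continuousAt_of_dominated (bound := fun y => ‖u y‖ * M)
    (Eventually.of_forall fun x => hu.aestronglyMeasurable.mul
      (hv.comp (measurable_const.sub measurable_id)).aestronglyMeasurable)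
    (Eventually.of_forall fun x => Eventually.of_forall fun y => ?_) (hu.norm.mul_const M) ?_
  · rw [norm_mul]
    exact mul_le_mul_of_nonneg_left (hM _) (norm_nonneg _)
  · refine ae_restrict_of_ae ?_
    have hne : ∀ᵐ y : ℝ, y ≠ b := by simp [ae_iff, measure_singleton]
    filter_upwards [hne] with y hy
    have h1 : ContinuousAt v (b - y) := hc _ (sub_ne_zero.2 hy.symm)
    exact continuousAt_const.mul
      (ContinuousAt.comp (f := fun x : ℝ => x - y) h1 (by fun_prop))

lemma tendsto_integral_mul_comp_sub {u v : ℝ → ℝ} {a M L : ℝ}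
    (hu : IntegrableOn u (Set.Ioi a)) (hv : Measurable v) (hM : ∀ x, |v x| ≤ M)
    (hL : Tendsto v atTop (nhds L)) :
    Tendsto (fun b => ∫ y in Set.Ioi a, u y * v (b - y)) atTop
      (nhds ((∫ y in Set.Ioi a, u y) * L)) := by
  rw [← integral_mul_const]
  refine tendsto_integral_filter_of_dominated_convergence (fun y => ‖u y‖ * M)
    (Eventually.of_forall fun x => hu.aestronglyMeasurable.mul
      (hv.comp (measurable_const.sub measurable_id)).aestronglyMeasurable)
    (Eventually.of_forall fun x => Eventually.of_forall fun y => ?_) (hu.norm.mul_const M)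
    (Eventually.of_forall fun y => ?_)
  · rw [norm_mul]
    exact mul_le_mul_of_nonneg_left (hM _) (norm_nonneg _)
  · exact tendsto_const_nhds.mul (hL.comp (tendsto_atTop_add_const_right atTop (-y) tendsto_id))

lemma exists_abs_le_of_tendsto {v : ℝ → ℝ} {L : ℝ} (h0 : ∀ x < 0, v x = 0)
    (hc : ContinuousOn v (Set.Ici 0)) (hL : Tendsto v atTop (nhds L)) :
    ∃ M, ∀ x, |v x| ≤ M := by
  obtain ⟨m, hm⟩ := eventually_atTop.1 (hL.abs.eventually_le_const (lt_add_one |L|))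
  obtain ⟨B, hB⟩ := (isCompact_Icc (a := (0:ℝ)) (b := m)).exists_bound_of_continuousOn
    (hc.mono Set.Icc_subset_Ici_self)
  refine ⟨max B (|L| + 1), fun x => ?_⟩
  rcases lt_or_ge x 0 with hx | hx
  · rw [h0 x hx, abs_zero]
    exact le_max_of_le_right (by positivity)
  rcases le_total x m with hxm | hxm
  · exact le_max_of_le_left (hB x ⟨hx, hxm⟩)
  · exact le_max_of_le_right (hm x hxm)

lemma continuousAt_of_ne_zero {v : ℝ → ℝ} (h0 : ∀ x < 0, v x = 0)
    (hc : ContinuousOn v (Set.Ici 0)) {x : ℝ} (hx : x ≠ 0) : ContinuousAt v x := by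
  rcases hx.lt_or_gt with hx | hx
  · refine (continuousAt_const (y := (0:ℝ))).congr ?_
    filter_upwards [eventually_lt_nhds hx] with y hy
    exact (h0 y hy).symm
  · exact hc.continuousAt (Ici_mem_nhds hx)

lemma tendsto_exp_mul_integral_s7 {c d r : ℝ} (hcd : c < d) {G : ℝ → ℝ} {a : ℝ}
    (hG : Continuous G) (hr : 0 < r) (hlim : Tendsto G atTop (nhds r)) :
    Tendsto (fun x => ∫ y in (0:ℝ)..x,
      Real.exp (-c * y) * (Real.exp (d * (y + a)) * G (y + a))) atTop atTop := by
  refine tendsto_intervalIntegral_atTop (by fun_prop) ?_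
  have h1 : Tendsto (fun y => Real.exp ((d - c) * y + d * a)) atTop atTop :=
    Real.tendsto_exp_atTop.comp (tendsto_atTop_add_const_right _ _
      (tendsto_id.const_mul_atTop (sub_pos.2 hcd)))
  have h2 := h1.atTop_mul_pos hr
    (hlim.comp (tendsto_atTop_add_const_right atTop a tendsto_id))
  refine h2.congr fun y => ?_
  rw [← mul_assoc, ← Real.exp_add]
  simp only [Function.comp, id]
  ring_nf

lemma rho_neg (W g : ℝ → ℝ) (a b : ℝ) : rho W (fun y => -g y) a b = -rho W g a b := by
  simp [rho, intervalIntegral.integral_neg]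

lemma tendsto_integral_rho_atTop {c d L : ℝ} (hcd : c < d) {W g : ℝ → ℝ}
    (hW0 : ∀ x < (0:ℝ), W x = 0) (hWcont : ContinuousOn W (Set.Ici 0))
    (hWmeas : Measurable W) (hL : 0 < L)
    (hWlim : Tendsto (fun x => Real.exp (-d * x) * W x) atTop (nhds L)) {a : ℝ}
    (hint : IntegrableOn (fun y => Real.exp (-d * y) * g y) (Set.Ioi a))
    (hpos : 0 < expTail d g a) :
    Tendsto (fun b => ∫ y in (0:ℝ)..(b - a), Real.exp (-c * y) * rho W g a (y + a))
      atTop atTop := by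
  have hv0 : ∀ x < 0, Real.exp (-d * x) * W x = 0 := fun x hx => by rw [hW0 x hx, mul_zero]
  have hvc : ContinuousOn (fun x => Real.exp (-d * x) * W x) (Set.Ici 0) :=
    (Continuous.continuousOn (by fun_prop)).mul hWcont
  have hvm : Measurable fun x => Real.exp (-d * x) * W x :=
    Measurable.mul (by fun_prop) hWmeas
  obtain ⟨M, hM⟩ := exists_abs_le_of_tendsto hv0 hvc hWlim
  have hG := continuous_integral_mul_comp_sub hint hvm hM
    fun x hx => continuousAt_of_ne_zero hv0 hvc hx
  have hGlim := tendsto_integral_mul_comp_sub hint hvm hM hWlim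
  have h := (tendsto_exp_mul_integral_s7 (a := a) hcd hG (mul_pos hpos hL) hGlim).comp
    (tendsto_atTop_add_const_right atTop (-a) tendsto_id)
  refine h.congr' ?_
  filter_upwards [eventually_ge_atTop a] with b hb
  refine intervalIntegral.integral_congr fun y hy => ?_
  change y ∈ Set.uIcc 0 (b - a) at hy
  rw [uIcc_of_le (by linarith)] at hy
  rw [rho_eq_exp_mul hW0 d (by linarith [hy.1])]

/-- Displays (Gamma_b_start) and (Gamma_b_asymp) of the paper. -/
theorem Gamma_start_and_asymp
    (q lam Phiq Phiql : ℝ) (hq : 0 < q) (hlam : 0 < lam)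
    (hPhiq : 0 < Phiq) (hPhi : Phiq < Phiql)
    (W : ℝ → ℝ)
    (hW0 : ∀ x < (0:ℝ), W x = 0)
    (hWnn : ∀ x ≥ (0:ℝ), 0 ≤ W x)
    (hWcont : ContinuousOn W (Set.Ici 0))
    (hWmono : StrictMonoOn W (Set.Ici 0))
    (hWC1 : ContDiffOn ℝ 1 W (Set.Ioi 0))
    (hWratio_mono : ∀ a y : ℝ, a < y →
      MonotoneOn (fun b => W (b - y) / W (b - a)) (Set.Ioi y))
    (hWratio_lim : ∀ a y : ℝ, a < y →
      Filter.Tendsto (fun b => W (b - y) / W (b - a)) Filter.atTop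
        (nhds (Real.exp (-Phiql * (y - a)))))
    (hWasymp : ∃ L : ℝ, 0 < L ∧
      Filter.Tendsto (fun x => Real.exp (-Phiql * x) * W x) Filter.atTop (nhds L))
    (f f' : ℝ → ℝ)
    (hf_conv : ConvexOn ℝ Set.univ f)
    (hf_deriv : ∀ x : ℝ, HasDerivWithinAt f (f' x) (Set.Ici x) x)
    (hf_pw : ∃ E : Set ℝ, E.Countable ∧ ∀ x ∉ E, ContinuousAt f' x)
    (hf_growth : ∃ C M : ℝ, ∃ N : ℕ, 0 < C ∧ 0 < M ∧
      ∀ x : ℝ, M < |x| → |f x| ≤ C * |x| ^ N)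
    (Kc Kp : ℝ) (hK : Kp < Kc)
    (g : ℝ → ℝ) (hg : ∀ x : ℝ, g x = f' x + q * Kc + lam * (Kc - Kp))
    (habar_ne : {a : ℝ | 0 ≤ g a}.Nonempty)
    (habar_bdd : BddBelow {a : ℝ | 0 ≤ g a})
    (habb_ne : {a : ℝ | 0 < f' a + q * Kp}.Nonempty)
    (habb_bdd : BddBelow {a : ℝ | 0 < f' a + q * Kp})
    (a1 a2 : ℝ)
    (ha1 : a1 = sInf {a : ℝ | 0 ≤ Gam1 lam Phiq Kp Kc g a})
    (ha2 : a2 = sInf {a : ℝ | 0 ≤ Gam2 Phiql g a}) :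
    (∀ a : ℝ, 0 < Gam1 lam Phiq Kp Kc g a ↔ a1 < a) ∧
    (∀ a : ℝ, a2 < a →
      Filter.Tendsto (fun b => Gam lam Phiq Kp Kc W g a b) Filter.atTop Filter.atTop) ∧
    (∀ a : ℝ, a < a2 →
      Filter.Tendsto (fun b => Gam lam Phiq Kp Kc W g a b) Filter.atTop Filter.atBot) := by
  obtain ⟨L, hL, hWlim⟩ := hWasymp
  have hPhiql : 0 < Phiql := hPhiq.trans hPhi
  have hWmeas : Measurable W := by
    refine Monotone.measurable fun x y hxy => ?_
    rcases lt_or_ge x 0 with hx | hx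
    · rw [hW0 x hx]
      rcases lt_or_ge y 0 with hy | hy
      · rw [hW0 y hy]
      · exact hWnn y hy
    · exact hWmono.monotoneOn hx (hx.trans hxy) hxy
  have hf'mono := monotone_rightDeriv hf_conv hf_deriv
  have hgeq : g = fun x => f' x + (q * Kc + lam * (Kc - Kp)) := by
    ext x
    rw [hg]
    ring
  have hgmono : Monotone g := by
    rw [hgeq]
    exact hf'mono.add_const _
  have hgO : ∀ e : ℝ, 0 < e → g =O[atTop] fun x => Real.exp (e * x) := fun e he => by
    rw [hgeq]
    exact (rightDeriv_isBigO_exp hf_conv hf_deriv hf_growth he).add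
      (const_isBigO_exp_mul_atTop _ he)
  have hint : ∀ c : ℝ, 0 < c → ∀ a,
      IntegrableOn (fun y => Real.exp (-c * y) * g y) (Set.Ioi a) := fun c hc a =>
    hgmono.integrableOn_exp_mul hc (hgO _ (half_pos hc)) a
  have hd : 0 < lam * (Kc - Kp) := mul_pos hlam (sub_pos.2 hK)
  have hqK : q * Kp < q * Kc := mul_lt_mul_of_pos_left hK hq
  obtain ⟨x₀, hx₀⟩ : ∃ x, g x < 0 := by
    obtain ⟨m, hm⟩ := habar_bdd
    refine ⟨m - 1, ?_⟩
    by_contra! h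
    linarith [hm h]
  obtain ⟨x₁, hx₁⟩ := habb_ne
  have hx₁' : 0 < f' x₁ + q * Kp := hx₁
  have hint' : ∀ a, IntegrableOn
      (fun y => Real.exp (-Phiq * y) * (g y - lam * (Kc - Kp))) (Set.Ioi a) := fun a => by
    simp only [mul_sub (Real.exp _) (g _)]
    exact (hint Phiq hPhiq a).sub
      ((integrableOn_exp_mul_Ioi (neg_lt_zero.2 hPhiq) a).mul_const (lam * (Kc - Kp)))
  have h1 := expTail_sign hPhiq (k := fun y => g y - lam * (Kc - Kp))
    (fun x y hxy => sub_le_sub_right (hgmono hxy) _) hint' ⟨x₀, by linarith⟩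
    ⟨x₁, by rw [hg]; linarith⟩
  have h2 := expTail_sign hPhiql hgmono (hint Phiql hPhiql) ⟨x₀, hx₀⟩
    ⟨x₁, by rw [hg]; linarith⟩
  have hG1 : ∀ a, Gam1 lam Phiq Kp Kc g a =
      Real.exp (Phiq * a) * expTail Phiq (fun y => g y - lam * (Kc - Kp)) a := fun a => by
    have he : Real.exp (Phiq * a) * Real.exp (-Phiq * a) = 1 := by
      rw [← Real.exp_add, Real.exp_eq_one_iff]
      ring
    rw [Gam1, integral_exp_mul_comp_add, expTail_sub_const hPhiq (hint Phiq hPhiq a)]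
    linear_combination (lam * (Kc - Kp) / Phiq) * he
  have hG2 : ∀ a, Gam2 Phiql g a = Real.exp (Phiql * a) * expTail Phiql g a := fun a =>
    integral_exp_mul_comp_add Phiql g a
  simp only [hG1, hG2, mul_nonneg_iff_of_pos_left (Real.exp_pos _)] at ha1 ha2
  subst ha1 ha2
  have hlast : ∀ a, Tendsto (fun b => lam / Phiq * Real.exp (-Phiq * (b - a)) * (Kp - Kc))
      atTop (nhds (lam / Phiq * 0 * (Kp - Kc))) := fun a => by
    refine ((Real.tendsto_exp_atBot.comp ?_).const_mul _).mul_const _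
    exact (tendsto_atTop_add_const_right atTop (-a) tendsto_id).const_mul_atTop_of_neg
      (neg_lt_zero.2 hPhiq)
  refine ⟨fun a => ?_, fun a ha => ?_, fun a ha => ?_⟩
  · rw [hG1, mul_pos_iff_of_pos_left (Real.exp_pos _), h1.1]
  · have hI := tendsto_integral_rho_atTop hPhi hW0 hWcont hWmeas hL hWlim
      (hint Phiql hPhiql a) ((h2.1 a).2 ha)
    exact (tendsto_atTop_add_const_left atTop _ (hI.const_mul_atTop hlam)).atTop_add (hlast a)
  · have hI := tendsto_integral_rho_atTop (g := fun y => -g y) (a := a) hPhi hW0 hWcont hWmeas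
      hL hWlim (by simp only [mul_neg]; exact (hint Phiql hPhiql a).neg)
      (by simpa [expTail, integral_neg] using h2.2 a ha)
    simp only [rho_neg, mul_neg, intervalIntegral.integral_neg] at hI
    have hI' := tendsto_neg_atTop_iff.1 hI
    exact (tendsto_atBot_add_const_left atTop _ (hI'.const_mul_atBot hlam)).atBot_add (hlast a)
end
end

section
/- Under the standing hypotheses on q, λ, Φ_q, Φ_{q+λ}, W, f, K_c, K_p listed in the context: (i) for every a < ā₂, the map b ↦ ρ_a(b) is strictly decreasing and strictly negative on (a, ∞); (ii) the map b ↦ ρ_{ā₂}(b) is non-increasing and non-positive on (ā₂, ∞). -/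
open MeasureTheory Filter Set Real

noncomputable section

lemma integral_Ioi_comp_add_right (φ : ℝ → ℝ) (a d : ℝ) :
    ∫ y in Ioi a, φ (y + d) = ∫ y in Ioi (a + d), φ y := by
  have h := (measurePreserving_add_right volume d).setIntegral_preimage_emb
    (measurableEmbedding_addRight d) φ (Ioi (a + d))
  simpa using h

lemma MeasureTheory.IntegrableOn.comp_add_right_Ioi {φ : ℝ → ℝ} {a d : ℝ}
    (h : IntegrableOn φ (Ioi (a + d))) : IntegrableOn (fun y => φ (y + d)) (Ioi a) := by
  have h' := ((measurePreserving_add_right volume d).integrableOn_comp_preimage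
    (measurableEmbedding_addRight d) (f := φ) (s := Ioi (a + d))).2 h
  simpa [Function.comp_def] using h'

lemma Gam2_eq (Φ : ℝ) (g : ℝ → ℝ) (a : ℝ) :
    Gam2 Φ g a = exp (Φ * a) * ∫ y in Ioi a, exp (-Φ * y) * g y := by
  have h := integral_Ioi_comp_add_right (fun y => exp (-Φ * (y - a)) * g y) 0 a
  simp only [add_sub_cancel_right, zero_add] at h
  rw [Gam2, h, ← integral_const_mul]
  congr 1
  funext y
  rw [← mul_assoc, ← exp_add]
  ring_nf

lemma monotone_of_convexOn_of_hasDerivWithinAt {f f' : ℝ → ℝ} (hf : ConvexOn ℝ univ f)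
    (hd : ∀ x, HasDerivWithinAt f (f' x) (Ici x) x) : Monotone f' := by
  have h : ∀ x, derivWithin f (Ioi x) x = f' x := fun x =>
    ((hd x).mono Ioi_subset_Ici_self).derivWithin (uniqueDiffWithinAt_Ioi x)
  have hm := hf.monotoneOn_rightDeriv
  simp only [interior_univ, h] at hm
  exact monotoneOn_univ.1 hm

lemma isBigO_exp_of_convexOn_of_growth {f f' : ℝ → ℝ} (hf : ConvexOn ℝ univ f)
    (hd : ∀ x, HasDerivWithinAt f (f' x) (Ici x) x)
    (hgrowth : ∃ C M : ℝ, ∃ N : ℕ, 0 < C ∧ 0 < M ∧ ∀ x : ℝ, M < |x| → |f x| ≤ C * |x| ^ N)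
    {c : ℝ} (hc : 0 < c) : f' =O[atTop] fun x => exp (c * x) := by
  obtain ⟨C, M, N, -, -, hb⟩ := hgrowth
  have hf_pow : f =O[atTop] fun x : ℝ => x ^ N := by
    refine Asymptotics.IsBigO.of_bound C ?_
    filter_upwards [eventually_gt_atTop M, eventually_ge_atTop 0] with x hx hx0
    simpa [abs_of_nonneg hx0] using hb x (by rwa [abs_of_nonneg hx0])
  have hf_exp : f =O[atTop] fun x => exp (c * x) :=
    hf_pow.trans (isLittleO_pow_exp_pos_mul_atTop N hc).isBigO
  have hf_shift : (fun x => f (x + 1)) =O[atTop] fun x => exp (c * x) := by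
    refine (hf_exp.comp_tendsto (tendsto_atTop_add_const_right atTop 1 tendsto_id)).trans ?_
    refine Asymptotics.IsBigO.of_bound (exp c) (Eventually.of_forall fun x => ?_)
    simp only [Function.comp_apply, id, norm_eq_abs, abs_exp]
    rw [← exp_add]
    apply le_of_eq
    ring_nf
  have hconst : (fun _ : ℝ => f' 0) =O[atTop] fun x => exp (c * x) := by
    refine Asymptotics.IsBigO.of_bound |f' 0| ?_
    filter_upwards [eventually_ge_atTop 0] with x hx
    simp only [norm_eq_abs, abs_exp]
    exact le_mul_of_one_le_right (abs_nonneg _) (one_le_exp (by positivity))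
  refine Asymptotics.IsBigO.trans (Asymptotics.IsBigO.of_bound 1 ?_)
    ((hf_shift.sub hf_exp).norm_left.add hconst.norm_left)
  filter_upwards [eventually_ge_atTop 0] with x hx
  have hlo := monotone_of_convexOn_of_hasDerivWithinAt hf hd hx
  have hup := hf.le_slope_of_hasDerivWithinAt_Ioi (mem_univ x) (mem_univ (x + 1))
    (by linarith) ((hd x).mono Ioi_subset_Ici_self)
  rw [slope_def_field, add_sub_cancel_left, div_one] at hup
  simp only [norm_eq_abs, one_mul]
  rw [abs_of_nonneg (add_nonneg (abs_nonneg (f (x + 1) - f x)) (abs_nonneg (f' 0)))]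
  have h1 := le_abs_self (f (x + 1) - f x)
  have h2 := neg_abs_le (f' 0)
  have h3 := abs_nonneg (f (x + 1) - f x)
  have h4 := abs_nonneg (f' 0)
  exact abs_le.2 ⟨by linarith, by linarith⟩

lemma integrableOn_Ioi_exp_neg_mul {g : ℝ → ℝ} (hg : Monotone g) {Φ : ℝ} (hΦ : 0 < Φ)
    (hO : g =O[atTop] fun x => exp (Φ / 2 * x)) (a : ℝ) :
    IntegrableOn (fun y => exp (-Φ * y) * g y) (Ioi a) := by
  have hexp : Continuous fun y : ℝ => exp (-Φ * y) := by fun_prop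
  have hloc : LocallyIntegrableOn (fun y => exp (-Φ * y) * g y) (Ici a) :=
    (hg.locallyIntegrable.locallyIntegrableOn (Ici a)).continuousOn_mul hexp.continuousOn
      isClosed_Ici.isLocallyClosed
  have hint : IntegrableAtFilter (fun x => exp (-(Φ / 2) * x)) atTop volume :=
    ⟨Ioi 0, Ioi_mem_atTop 0, exp_neg_integrableOn_Ioi 0 (half_pos hΦ)⟩
  refine (hloc.integrableOn_of_isBigO_atTop ?_ hint).mono_set Ioi_subset_Ici_self
  refine ((Asymptotics.isBigO_refl (fun y => exp (-Φ * y)) atTop).mul hO).congr_right fun x => ?_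
  rw [← exp_add]
  ring_nf

/-- If `g` is monotone and negative somewhere, then `Γ₂ < 0` far to the left. -/
lemma bddBelow_setOf_Gam2_nonneg {g : ℝ → ℝ} (hg : Monotone g) {Φ : ℝ}
    (hint : ∀ a, IntegrableOn (fun y => exp (-Φ * y) * g y) (Ioi a)) (hΦ : 0 < Φ)
    {c : ℝ} (hc : g c < 0) : BddBelow {a | 0 ≤ Gam2 Φ g a} := by
  set G : ℝ := ∫ y in Ioi c, exp (-Φ * y) * g y with hG
  set k : ℝ := exp (-Φ * c) * g c with hk
  have hk0 : k < 0 := mul_neg_of_pos_of_neg (exp_pos _) hc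
  refine ⟨min c (c + G / k), fun a ha => ?_⟩
  by_contra! hlt
  obtain ⟨hac, haG⟩ := lt_min_iff.1 hlt
  have hsplit := intervalIntegral.integral_interval_add_Ioi (hint a) (hint c)
  have hle : ∫ y in a..c, exp (-Φ * y) * g y ≤ ∫ _ in a..c, k := by
    refine intervalIntegral.integral_mono_on hac.le ?_ intervalIntegrable_const fun y hy => ?_
    · exact (intervalIntegrable_iff_integrableOn_Ioc_of_le hac.le).2
        ((hint a).mono_set Ioc_subset_Ioi_self)
    · have h1 : exp (-Φ * c) ≤ exp (-Φ * y) := exp_le_exp.2 (by nlinarith [hy.2])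
      have h2 := hg hy.2
      nlinarith [exp_pos (-Φ * c)]
  rw [intervalIntegral.integral_const, smul_eq_mul] at hle
  have hneg : (c - a) * k + G < 0 := by
    have : G / k > a - c := by linarith
    rw [gt_iff_lt, lt_div_iff_of_neg hk0] at this
    linarith
  have : Gam2 Φ g a < 0 := by
    rw [Gam2_eq, ← hsplit]
    exact mul_neg_of_pos_of_neg (exp_pos _) (by linarith)
  exact this.not_ge ha

lemma exists_gt_neg_of_Gam2_neg {Φ : ℝ} {g : ℝ → ℝ} {a : ℝ} (h : Gam2 Φ g a < 0) :
    ∃ c > a, g c < 0 := by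
  by_contra! hc
  refine h.not_ge ?_
  rw [Gam2_eq]
  exact mul_nonneg (exp_pos _).le
    (setIntegral_nonneg measurableSet_Ioi fun y hy => mul_nonneg (exp_pos _).le (hc y hy))

lemma scale_le_exp_mul {W : ℝ → ℝ} {Φ : ℝ} (hpos : ∀ x > 0, 0 < W x)
    (hmono : ∀ a y : ℝ, a < y → MonotoneOn (fun b => W (b - y) / W (b - a)) (Ioi y))
    (hlim : ∀ a y : ℝ, a < y →
      Tendsto (fun b => W (b - y) / W (b - a)) atTop (nhds (exp (-Φ * (y - a)))))
    {x d : ℝ} (hx : 0 < x) (hd : 0 < d) : W x ≤ exp (-Φ * d) * W (x + d) := by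
  have h : W (x + d - d) / W (x + d - 0) ≤ exp (-Φ * (d - 0)) := by
    refine ge_of_tendsto (hlim 0 d hd) ?_
    filter_upwards [eventually_ge_atTop (x + d)] with b hb
    have hxd : d < x + d := by linarith
    exact hmono 0 d hd hxd (hxd.trans_le hb) hb
  rw [add_sub_cancel_right, sub_zero, sub_zero, div_le_iff₀ (hpos _ (by linarith))] at h
  exact h

lemma intervalIntegrable_mul_comp_sub {g W : ℝ → ℝ} (hg : Monotone g)
    (hW : ContinuousOn W (Ici 0)) {a b x : ℝ} (hab : a ≤ b) (hbx : b ≤ x) :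
    IntervalIntegrable (fun y => g y * W (x - y)) volume a b := by
  refine hg.intervalIntegrable.mul_continuousOn (hW.comp (by fun_prop) fun y hy => ?_)
  rw [uIcc_of_le hab] at hy
  exact sub_nonneg.2 (hy.2.trans hbx)

/-- Increments of `rho` over a step `d` such that `g ≤ 0` on `(a, a + d)`. -/
lemma rho_add_lt {g W : ℝ → ℝ} {Φ : ℝ} (hΦ : 0 < Φ) (hg : Monotone g)
    (hint : ∀ a, IntegrableOn (fun y => exp (-Φ * y) * g y) (Ioi a))
    (hW : ContinuousOn W (Ici 0)) (hpos : ∀ x > 0, 0 < W x)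
    (hexp : ∀ x > 0, ∀ d > 0, W x ≤ exp (-Φ * d) * W (x + d))
    {a b d : ℝ} (hab : a < b) (hd : 0 < d) (hgd : ∀ y ∈ Ioo a (a + d), g y ≤ 0)
    (hneg : Gam2 Φ g a < 0) : rho W g a (b + d) < rho W g a b := by
  set e : ℝ → ℝ := fun y => exp (-Φ * y) * g y with he
  have hint_e : ∀ u v, u ≤ v → IntervalIntegrable e volume u v := fun u v huv =>
    (intervalIntegrable_iff_integrableOn_Ioc_of_le huv).2
      ((hint u).mono_set Ioc_subset_Ioi_self)
  set w : ℝ := W (b - a) * exp (Φ * a) with hw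
  have hw0 : 0 < w := mul_pos (hpos _ (by linarith)) (exp_pos _)
  have hsplit : rho W g a (b + d) =
      (∫ y in a..(a + d), g y * W (b + d - y)) + ∫ y in a..b, g (y + d) * W (b - y) := by
    have hshift := intervalIntegral.integral_comp_add_right
      (a := a) (b := b) (fun y => g y * W (b + d - y)) d
    simp only [add_sub_add_right_eq_sub] at hshift
    rw [hshift, rho, intervalIntegral.integral_add_adjacent_intervals]
    · exact intervalIntegrable_mul_comp_sub hg hW (by linarith) (by linarith)
    · exact intervalIntegrable_mul_comp_sub hg hW (by linarith) le_rfl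
  have hgshift : Monotone fun y => g (y + d) := fun x y hxy => hg (by linarith)
  have hleft : ∫ y in a..(a + d), g y * W (b + d - y) ≤
      w * exp (Φ * d) * ∫ y in a..(a + d), e y := by
    rw [← intervalIntegral.integral_const_mul]
    refine intervalIntegral.integral_mono_on_of_le_Ioo (by linarith)
      (intervalIntegrable_mul_comp_sub hg hW (by linarith) (by linarith))
      ((hint_e _ _ (by linarith)).const_mul _) fun y hy => ?_
    have h := hexp (b - a) (by linarith) (a + d - y) (by linarith [hy.2])
    rw [show b - a + (a + d - y) = b + d - y by ring, ← mul_le_mul_iff_right₀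
      (exp_pos (Φ * (a + d - y))), ← mul_assoc, ← exp_add,
      show Φ * (a + d - y) + -Φ * (a + d - y) = 0 by ring, exp_zero, one_mul] at h
    calc g y * W (b + d - y) ≤ g y * (exp (Φ * (a + d - y)) * W (b - a)) :=
          mul_le_mul_of_nonpos_left h (hgd y hy)
      _ = w * exp (Φ * d) * e y := by
          rw [show Φ * (a + d - y) = Φ * a + Φ * d + -Φ * y by ring, exp_add, exp_add]
          simp only [hw, he]
          ring
  have hintd : IntegrableOn (fun y => exp (Φ * d) * e (y + d)) (Ioi a) :=
    (hint (a + d)).comp_add_right_Ioi.const_mul _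
  have hdiff : ∀ y, exp (Φ * d) * e (y + d) - e y = exp (-Φ * y) * (g (y + d) - g y) := by
    intro y
    simp only [he]
    rw [← mul_assoc, ← exp_add, show Φ * d + -Φ * (y + d) = -Φ * y by ring]
    ring
  have hright : (∫ y in a..b, g (y + d) * W (b - y)) - ∫ y in a..b, g y * W (b - y) ≤
      w * ∫ y in Ioi a, (exp (Φ * d) * e (y + d) - e y) := by
    rw [← intervalIntegral.integral_sub
      (intervalIntegrable_mul_comp_sub hgshift hW hab.le le_rfl)
      (intervalIntegrable_mul_comp_sub hg hW hab.le le_rfl)]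
    have hI : IntegrableOn (fun y => w * (exp (Φ * d) * e (y + d) - e y)) (Ioi a) :=
      (hintd.sub (hint a)).const_mul _
    calc _ ≤ ∫ y in a..b, w * (exp (Φ * d) * e (y + d) - e y) := by
          refine intervalIntegral.integral_mono_on_of_le_Ioo hab.le
            ((intervalIntegrable_mul_comp_sub hgshift hW hab.le le_rfl).sub
              (intervalIntegrable_mul_comp_sub hg hW hab.le le_rfl))
            ((intervalIntegrable_iff_integrableOn_Ioc_of_le hab.le).2
              (hI.mono_set Ioc_subset_Ioi_self)) fun y hy => ?_
          have h := hexp (b - y) (by linarith [hy.2]) (y - a) (by linarith [hy.1])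
          rw [show b - y + (y - a) = b - a by ring] at h
          have hg0 : 0 ≤ g (y + d) - g y := sub_nonneg.2 (hg (by linarith))
          calc g (y + d) * W (b - y) - g y * W (b - y) = (g (y + d) - g y) * W (b - y) := by ring
            _ ≤ (g (y + d) - g y) * (exp (-Φ * (y - a)) * W (b - a)) := by gcongr
            _ = w * (exp (Φ * d) * e (y + d) - e y) := by
                rw [hdiff, show -Φ * (y - a) = Φ * a + -Φ * y by ring, exp_add, hw]
                ring
      _ ≤ ∫ y in Ioi a, w * (exp (Φ * d) * e (y + d) - e y) := by
          rw [intervalIntegral.integral_of_le hab.le]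
          refine setIntegral_mono_set hI (Eventually.of_forall fun y => ?_)
            Ioc_subset_Ioi_self.eventuallyLE
          simp only [Pi.zero_apply, hdiff]
          exact mul_nonneg hw0.le (mul_nonneg (exp_pos _).le (sub_nonneg.2 (hg (by linarith))))
      _ = _ := integral_const_mul _ _
  have hIoi : ∫ y in Ioi a, (exp (Φ * d) * e (y + d) - e y) =
      exp (Φ * d) * (∫ y in Ioi (a + d), e y) - ∫ y in Ioi a, e y := by
    rw [integral_sub hintd (hint a), integral_const_mul, integral_Ioi_comp_add_right]
  have hadd := intervalIntegral.integral_interval_add_Ioi (hint a) (hint (a + d))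
  have hG : ∫ y in Ioi a, e y < 0 := by
    rw [Gam2_eq] at hneg
    exact (pos_iff_neg_of_mul_neg hneg).1 (exp_pos _)
  have hfin : w * (exp (Φ * d) - 1) * (∫ y in Ioi a, e y) < 0 :=
    mul_neg_of_pos_of_neg (mul_pos hw0 (sub_pos.2 (one_lt_exp_iff.2 (by positivity)))) hG
  have hsum : w * exp (Φ * d) * (∫ y in a..(a + d), e y) +
      w * (exp (Φ * d) * (∫ y in Ioi (a + d), e y) - ∫ y in Ioi a, e y) =
      w * (exp (Φ * d) - 1) * ∫ y in Ioi a, e y := by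
    rw [← hadd]
    ring
  rw [hIoi] at hright
  rw [hsplit, rho]
  linarith

lemma strictAntiOn_Ioi_of_forall_add_lt {φ : ℝ → ℝ} {a r : ℝ} (hr : 0 < r)
    (h : ∀ b > a, ∀ d, 0 < d → d ≤ r → φ (b + d) < φ b) : StrictAntiOn φ (Ioi a) := by
  have key : ∀ n : ℕ, ∀ b > a, ∀ d, 0 < d → d ≤ n * r → φ (b + d) < φ b := by
    intro n
    induction n with
    | zero =>
      intro b _ d hd hd'
      simp only [Nat.cast_zero, zero_mul] at hd'
      exact absurd hd hd'.not_gt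
    | succ n ih =>
      intro b hb d hd hd'
      by_cases hdr : d ≤ r
      · exact h b hb d hd hdr
      · push Not at hdr
        push_cast at hd'
        have h1 := ih (b + r) (by linarith) (d - r) (by linarith) (by linarith)
        rw [show b + r + (d - r) = b + d by ring] at h1
        exact h1.trans (h b hb r hr le_rfl)
  intro x hx y _ hxy
  obtain ⟨n, hn⟩ := exists_nat_ge ((y - x) / r)
  have h1 := key n x hx (y - x) (sub_pos.2 hxy) ((div_le_iff₀ hr).1 hn)
  rwa [add_sub_cancel] at h1

/-- Lemma 5.3 (rho monotone) of the paper. -/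
theorem rho_monotone
    (q lam Phiq Phiql : ℝ) (hq : 0 < q) (hlam : 0 < lam)
    (hPhiq : 0 < Phiq) (hPhi : Phiq < Phiql)
    (W : ℝ → ℝ)
    (hW0 : ∀ x < (0:ℝ), W x = 0)
    (hWnn : ∀ x ≥ (0:ℝ), 0 ≤ W x)
    (hWcont : ContinuousOn W (Set.Ici 0))
    (hWmono : StrictMonoOn W (Set.Ici 0))
    (hWC1 : ContDiffOn ℝ 1 W (Set.Ioi 0))
    (hWratio_mono : ∀ a y : ℝ, a < y →
      MonotoneOn (fun b => W (b - y) / W (b - a)) (Set.Ioi y))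
    (hWratio_lim : ∀ a y : ℝ, a < y →
      Filter.Tendsto (fun b => W (b - y) / W (b - a)) Filter.atTop
        (nhds (Real.exp (-Phiql * (y - a)))))
    (hWasymp : ∃ L : ℝ, 0 < L ∧
      Filter.Tendsto (fun x => Real.exp (-Phiql * x) * W x) Filter.atTop (nhds L))
    (f f' : ℝ → ℝ)
    (hf_conv : ConvexOn ℝ Set.univ f)
    (hf_deriv : ∀ x : ℝ, HasDerivWithinAt f (f' x) (Set.Ici x) x)
    (hf_pw : ∃ E : Set ℝ, E.Countable ∧ ∀ x ∉ E, ContinuousAt f' x)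
    (hf_growth : ∃ C M : ℝ, ∃ N : ℕ, 0 < C ∧ 0 < M ∧
      ∀ x : ℝ, M < |x| → |f x| ≤ C * |x| ^ N)
    (Kc Kp : ℝ) (hK : Kp < Kc)
    (g : ℝ → ℝ) (hg : ∀ x : ℝ, g x = f' x + q * Kc + lam * (Kc - Kp))
    (habar_ne : {a : ℝ | 0 ≤ g a}.Nonempty)
    (habar_bdd : BddBelow {a : ℝ | 0 ≤ g a})
    (habb_ne : {a : ℝ | 0 < f' a + q * Kp}.Nonempty)
    (habb_bdd : BddBelow {a : ℝ | 0 < f' a + q * Kp})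
    (a2 : ℝ) (ha2 : a2 = sInf {a : ℝ | 0 ≤ Gam2 Phiql g a}) :
    (∀ a : ℝ, a < a2 →
      StrictAntiOn (fun b => rho W g a b) (Set.Ioi a) ∧
      ∀ b : ℝ, a < b → rho W g a b < 0) ∧
    (AntitoneOn (fun b => rho W g a2 b) (Set.Ioi a2) ∧
      ∀ b : ℝ, a2 < b → rho W g a2 b ≤ 0) := by
  have hpos : ∀ x > 0, 0 < W x := fun x hx =>
    (hWnn 0 le_rfl).trans_lt (hWmono self_mem_Ici hx.le hx)
  have hΦ : 0 < Phiql := hPhiq.trans hPhi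
  have hexp : ∀ x > 0, ∀ d > 0, W x ≤ exp (-Phiql * d) * W (x + d) := fun x hx d hd =>
    scale_le_exp_mul hpos hWratio_mono hWratio_lim hx hd
  have hgmono : Monotone g := fun x y hxy => by
    rw [hg, hg]
    linarith [monotone_of_convexOn_of_hasDerivWithinAt hf_conv hf_deriv hxy]
  have hgO : g =O[atTop] fun x => exp (Phiql / 2 * x) := by
    have hconst : (fun _ : ℝ => q * Kc + lam * (Kc - Kp)) =O[atTop]
        fun x => exp (Phiql / 2 * x) := by
      refine Asymptotics.IsBigO.of_bound |q * Kc + lam * (Kc - Kp)| ?_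
      filter_upwards [eventually_ge_atTop 0] with x hx
      simp only [norm_eq_abs, abs_exp]
      exact le_mul_of_one_le_right (abs_nonneg _) (one_le_exp (by positivity))
    refine ((isBigO_exp_of_convexOn_of_growth hf_conv hf_deriv hf_growth
      (half_pos hΦ)).add hconst).congr_left fun x => ?_
    rw [hg]
    ring
  have hint := integrableOn_Ioi_exp_neg_mul hgmono hΦ hgO
  obtain ⟨m, hm⟩ := habar_bdd
  have hgm : g (m - 1) < 0 := by
    by_contra! h
    linarith [hm h]
  have hbdd := bddBelow_setOf_Gam2_nonneg hgmono hint hΦ hgm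
  have hbelow : ∀ a : ℝ, a < a2 →
      StrictAntiOn (fun b => rho W g a b) (Ioi a) ∧ ∀ b : ℝ, a < b → rho W g a b < 0 := by
    intro a ha
    have hneg : Gam2 Phiql g a < 0 := by
      rw [ha2] at ha
      exact not_le.1 fun h => notMem_of_lt_csInf ha hbdd h
    obtain ⟨c, hac, hc⟩ := exists_gt_neg_of_Gam2_neg hneg
    have hanti : StrictAntiOn (fun b => rho W g a b) (Ioi a) := by
      refine strictAntiOn_Ioi_of_forall_add_lt (sub_pos.2 hac) fun b hb d hd hdc => ?_
      refine rho_add_lt hΦ hgmono hint hWcont hpos hexp hb hd (fun y hy => ?_) hneg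
      exact (hgmono (show y ≤ c by linarith [hy.2])).trans hc.le
    refine ⟨hanti, fun b hb => ?_⟩
    obtain ⟨x, hax, hx⟩ := exists_between (lt_min hb hac)
    obtain ⟨hxb, hxc⟩ := lt_min_iff.1 hx
    refine (hanti hax hb hxb).trans_le ?_
    simp only [rho]
    rw [intervalIntegral.integral_of_le hax.le, integral_Ioc_eq_integral_Ioo]
    refine setIntegral_nonpos measurableSet_Ioo fun y hy => mul_nonpos_of_nonpos_of_nonneg ?_
      (hpos _ (sub_pos.2 hy.2)).le
    exact (hgmono (hy.2.trans hxc).le).trans hc.le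
  have hcont : ∀ b, a2 < b →
      Tendsto (fun a => rho W g a b) (nhdsWithin a2 (Iio a2)) (nhds (rho W g a2 b)) := by
    intro b hb
    have hI : IntegrableOn (fun y => g y * W (b - y)) (uIcc (a2 - 1) b) := by
      rw [uIcc_of_le (by linarith)]
      exact (intervalIntegrable_iff_integrableOn_Icc_of_le (by linarith)).1
        (intervalIntegrable_mul_comp_sub hgmono hWcont (by linarith) le_rfl)
    have h := intervalIntegral.continuousOn_primitive_interval_left hI
    rw [uIcc_of_le (by linarith)] at h
    exact ((h.continuousAt (Icc_mem_nhds (by linarith) hb)).tendsto).mono_left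
      nhdsWithin_le_nhds
  refine ⟨hbelow, fun x hx y hy hxy => ?_, fun b hb => ?_⟩
  · refine le_of_tendsto_of_tendsto (hcont y hy) (hcont x hx) ?_
    filter_upwards [self_mem_nhdsWithin] with a ha
    exact (hbelow a ha).1.antitoneOn (mem_Ioi.2 (lt_trans ha hx)) (mem_Ioi.2 (lt_trans ha hy)) hxy
  · refine le_of_tendsto (hcont b hb) ?_
    filter_upwards [self_mem_nhdsWithin] with a ha
    exact ((hbelow a ha).2 b (lt_trans ha hb)).le
end
end
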